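/- arXiv:math/0604408 — 3 statements merged into one kernel-verified Lean document; each statement's English description precedes it below -/
import Mathlib

section
/- Let J, g, g′ : ℝ⁴ → M₄(ℝ) be C¹ maps such that at every point J² = −I₄, g and g′ are symmetric, JᵀgJ = g and Jᵀg′J = g′. Let J₀ denote the standard almost complex structure on ℝ⁴, i.e. the matrix with entries (J₀)₁{}^3 = (J₀)₂{}^4 = 1, (J₀)₃{}^1 = (J₀)₄{}^2 = −1 and all other entries 0. Assume g(0) = 2·I₄, all first partial derivatives of the entries of g vanish at 0, J(0) = J₀, and the 2×2 complex matrix G′(0) is diagonal, where for α,β ∈ {1,2}: G_{αβ} = ½(g_{αβ} − √−1 J_{αβ}) with J_{ij} = Σ_k J_i{}^k g_{kj}, G′_{αβ} = ½(g′_{αβ} − √−1 J′_{αβ}) with J′_{ij} = Σ_k J_i{}^k g′_{kj}, and G̃_{αβ} = ½(g_{AB} − √−1 J_{AB}), G̃′_{αβ} = ½(g′_{AB} − √−1 J′_{AB}) with A = α+2, B = β+2. For γ ∈ {1,2} let D_γ f = ½(∂_γ f − √−1 Σ_k J_γ{}^k ∂_k f). Then G and G̃ are invertible near 0, and at the point 0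 one has, for γ ∈ {1,2}: 2 D_γ(tr(G⁻¹G′)) = 2 Σ_{α,β} (G(0)⁻¹)_{βα} (D_γ G′_{αβ})(0) = D_γ(Σ_{i,j} g^{ij} g′_{ij}) + E_γ, and 2 D_γ(tr(G̃⁻¹G̃′)) = D_γ(Σ_{i,j} g^{ij} g′_{ij}) − E_γ, where g^{ij} denotes the entries of g(x)⁻¹ and E_γ = Σ_{i=1}^{2} Σ_{r,s} g′_{rs}(0) (D_γ J_i{}^r)(0) J_i{}^s(0). -/
open Matrix

/-- Partial derivative `∂_i f` of a real-valued function on `ℝ⁴`. -/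
noncomputable def pdR (i : Fin 4) (f : (Fin 4 → ℝ) → ℝ) (x : Fin 4 → ℝ) : ℝ :=
  fderiv ℝ f x (Pi.single i 1)

/-- Partial derivative `∂_i f` of a complex-valued function on `ℝ⁴`. -/
noncomputable def pdC (i : Fin 4) (f : (Fin 4 → ℝ) → ℂ) (x : Fin 4 → ℝ) : ℂ :=
  fderiv ℝ f x (Pi.single i 1)

/-- The complex first-order operator `D_γ f = ½(∂_γ f − i Σ_k J_γ{}^k ∂_k f)`. -/
noncomputable def Dop (J : (Fin 4 → ℝ) → Matrix (Fin 4) (Fin 4) ℝ) (γ : Fin 4)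
    (f : (Fin 4 → ℝ) → ℂ) (x : Fin 4 → ℝ) : ℂ :=
  (1 / 2) * (pdC γ f x - Complex.I * ∑ k, (J x γ k : ℂ) * pdC k f x)

/-- The inclusion `{1,2} ↪ {1,2,3,4}`, `α ↦ α`. -/
def emb : Fin 2 → Fin 4 := fun a => ⟨a.val, by omega⟩

/-- The shifted inclusion `{1,2} ↪ {1,2,3,4}`, `α ↦ A = α + 2`. -/
def embA : Fin 2 → Fin 4 := fun a => ⟨a.val + 2, by omega⟩

/-- The standard almost complex structure `J₀` on `ℝ⁴`. -/
def J0 : Matrix (Fin 4) (Fin 4) ℝ :=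
  !![0, 0, 1, 0; 0, 0, 0, 1; -1, 0, 0, 0; 0, -1, 0, 0]


/-- `f` is differentiable at `0` with derivative `a` in the `k`-th coordinate direction. -/
def HD {F : Type*} [NormedAddCommGroup F] [NormedSpace ℝ F] (k : Fin 4)
    (f : (Fin 4 → ℝ) → F) (a : F) : Prop :=
  ∃ L : (Fin 4 → ℝ) →L[ℝ] F, HasFDerivAt f L 0 ∧ L (Pi.single k 1) = a

namespace HD

section general
variable {F : Type*} [NormedAddCommGroup F] [NormedSpace ℝ F] {k : Fin 4}

theorem unique {f : (Fin 4 → ℝ) → F} {a b : F} (h : HD k f a) (h' : HD k f b) : a = b := by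
  obtain ⟨L, hL, rfl⟩ := h
  obtain ⟨M, hM, rfl⟩ := h'
  rw [hL.unique hM]

theorem cast {f f' : (Fin 4 → ℝ) → F} {a b : F} (h : HD k f a) (hf : ∀ x, f' x = f x)
    (hb : b = a) : HD k f' b := by
  obtain rfl : f' = f := funext hf
  rw [hb]
  exact h

theorem const (c : F) : HD k (fun _ => c) 0 :=
  ⟨0, hasFDerivAt_const c 0, rfl⟩

theorem add {f f' : (Fin 4 → ℝ) → F} {a b : F} (h : HD k f a) (h' : HD k f' b) :
    HD k (fun x => f x + f' x) (a + b) := by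
  obtain ⟨L, hL, rfl⟩ := h
  obtain ⟨M, hM, rfl⟩ := h'
  exact ⟨_, hL.add hM, rfl⟩

theorem sub {f f' : (Fin 4 → ℝ) → F} {a b : F} (h : HD k f a) (h' : HD k f' b) :
    HD k (fun x => f x - f' x) (a - b) := by
  obtain ⟨L, hL, rfl⟩ := h
  obtain ⟨M, hM, rfl⟩ := h'
  exact ⟨_, hL.sub hM, rfl⟩

theorem sum {ι : Type*} [Fintype ι] {f : ι → (Fin 4 → ℝ) → F} {a : ι → F}
    (h : ∀ i, HD k (f i) (a i)) : HD k (fun x => ∑ i, f i x) (∑ i, a i) := by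
  choose L hL hLa using h
  refine ⟨∑ i, L i, HasFDerivAt.fun_sum fun i _ => hL i, ?_⟩
  simp [hLa]

end general

theorem mul {𝔸 : Type*} [NormedCommRing 𝔸] [NormedAlgebra ℝ 𝔸] {k : Fin 4}
    {f f' : (Fin 4 → ℝ) → 𝔸} {a b : 𝔸} (h : HD k f a) (h' : HD k f' b) :
    HD k (fun x => f x * f' x) (a * f' 0 + f 0 * b) := by
  obtain ⟨L, hL, rfl⟩ := h
  obtain ⟨M, hM, rfl⟩ := h'
  refine ⟨_, hL.mul hM, ?_⟩
  simp [mul_comm, add_comm]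

theorem ofReal {k : Fin 4} {f : (Fin 4 → ℝ) → ℝ} {a : ℝ} (h : HD k f a) :
    HD k (fun x => (f x : ℂ)) (a : ℂ) := by
  obtain ⟨L, hL, rfl⟩ := h
  exact ⟨Complex.ofRealCLM.comp L, Complex.ofRealCLM.hasFDerivAt.comp 0 hL, rfl⟩

theorem pdC {k : Fin 4} {f : (Fin 4 → ℝ) → ℂ} {a : ℂ} (h : HD k f a) : pdC k f 0 = a := by
  obtain ⟨L, hL, rfl⟩ := h
  rw [_root_.pdC, hL.fderiv]

theorem of_contDiff {k : Fin 4} {f : (Fin 4 → ℝ) → ℝ} (h : ContDiff ℝ 1 f) :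
    HD k f (pdR k f 0) :=
  ⟨_, (h.differentiable (by norm_num) 0).hasFDerivAt, rfl⟩

section inverse
attribute [local instance] Matrix.linftyOpNormedRing Matrix.linftyOpNormedAlgebra
  Matrix.linftyOpNormedAddCommGroup Matrix.linftyOpNormedSpace

theorem inv {𝕂 : Type*} [RCLike 𝕂] {n : ℕ} {k : Fin 4}
    {M : (Fin 4 → ℝ) → Matrix (Fin n) (Fin n) 𝕂} {M' : Matrix (Fin n) (Fin n) 𝕂}
    (h : ∀ i j, HD k (fun x => M x i j) (M' i j)) (hu : IsUnit (M 0)) (i j : Fin n) :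
    HD k (fun x => (M x)⁻¹ i j) (-((M 0)⁻¹ * M' * (M 0)⁻¹) i j) := by
  choose L hL hLa using h
  let T : (Fin 4 → ℝ) →L[ℝ] Matrix (Fin n) (Fin n) 𝕂 :=
    LinearMap.toContinuousLinearMap
      { toFun := fun v => Matrix.of fun i j => L i j v
        map_add' := by intro v w; ext i j; simp
        map_smul' := by intro c v; ext i j; simp }
  let ev : Matrix (Fin n) (Fin n) 𝕂 →L[ℝ] 𝕂 :=
    LinearMap.toContinuousLinearMap
      { toFun := fun A => A i j
        map_add' := by intro v w; rfl
        map_smul' := by intro c v; rfl }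
  let S : Fin n → Fin n → 𝕂 →L[ℝ] Matrix (Fin n) (Fin n) 𝕂 := fun i j =>
    LinearMap.toContinuousLinearMap
      { toFun := fun c => Matrix.single i j c
        map_add' := by intro v w; exact Matrix.single_add i j v w
        map_smul' := by intro c v; simp [Matrix.smul_single] }
  have hM : HasFDerivAt M T 0 := by
    have h1 : HasFDerivAt (fun x => ∑ i, ∑ j, S i j (M x i j))
        (∑ i, ∑ j, (S i j).comp (L i j)) 0 :=
      HasFDerivAt.fun_sum fun i _ => HasFDerivAt.fun_sum fun j _ =>
        (S i j).hasFDerivAt.comp 0 (hL i j)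
    have h2 : (fun x => ∑ i, ∑ j, S i j (M x i j)) = M := by
      funext x
      exact (Matrix.matrix_eq_sum_single (M x)).symm
    have h3 : (∑ i, ∑ j, (S i j).comp (L i j)) = T := by
      ext1 v
      simp only [_root_.sum_apply]
      exact (Matrix.matrix_eq_sum_single (T v)).symm
    rw [h2, h3] at h1
    exact h1
  obtain ⟨u, hu⟩ := hu
  have hinv := hasFDerivAt_ringInverse (𝕜 := ℝ) u
  rw [hu] at hinv
  have hcomp := ev.hasFDerivAt.comp 0 (hinv.comp 0 hM)
  have hui : ((u⁻¹ : (Matrix (Fin n) (Fin n) 𝕂)ˣ) : Matrix (Fin n) (Fin n) 𝕂) = (M 0)⁻¹ := by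
    rw [← hu, Matrix.coe_units_inv]
  have hT : T (Pi.single k 1) = M' := by
    ext a b
    exact hLa a b
  refine ⟨_, hcomp.congr_of_eventuallyEq (Filter.Eventually.of_forall fun x => ?_), ?_⟩
  · change (M x)⁻¹ i j = (Ring.inverse (M x)) i j
    rw [Matrix.nonsing_inv_eq_ringInverse]
  · change (-(((u⁻¹ : (Matrix (Fin n) (Fin n) 𝕂)ˣ) : Matrix (Fin n) (Fin n) 𝕂) *
      T (Pi.single k 1) * ((u⁻¹ : (Matrix (Fin n) (Fin n) 𝕂)ˣ) : Matrix (Fin n) (Fin n) 𝕂))) i j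
        = _
    rw [hT, hui]
    rfl

end inverse

end HD

/-- `D_γ` as a fixed linear combination of partial derivatives. -/
theorem Dop_eq_sum (J : (Fin 4 → ℝ) → Matrix (Fin 4) (Fin 4) ℝ) (γ : Fin 4) :
    ∃ c : Fin 4 → ℂ, ∀ f, Dop J γ f 0 = ∑ k, c k * pdC k f 0 := by
  refine ⟨fun k => (1 / 2) * ((if k = γ then 1 else 0) - Complex.I * (J 0 γ k : ℂ)), fun f => ?_⟩
  simp only [Dop, mul_sub, sub_mul, Finset.sum_sub_distrib, Finset.mul_sum]
  congr 1
  · simp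
  · refine Finset.sum_congr rfl fun k _ => by ring

/-- The algebraic heart: consequences of compatibility, differentiated in one direction. -/
theorem alg_core (A H P : Matrix (Fin 4) (Fin 4) ℝ) (hA : Aᵀ = -A) (hH : Hᵀ = H) (hP : Pᵀ = P)
    (hAJ : A * J0 + J0 * A = 0) (hHJ : J0ᵀ * H * J0 = H)
    (hc : (Aᵀ * H + J0ᵀ * P) * J0 + (J0ᵀ * H) * A = P) :
    (∀ i, (A * H + J0 * P) i i = 0) ∧
    P 0 0 - P 2 2 = 2 * (A * H * J0ᵀ) 0 0 ∧ P 1 1 - P 3 3 = 2 * (A * H * J0ᵀ) 1 1 := by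
  have hJT : J0ᵀ = -J0 := by
    ext i j; fin_cases i <;> fin_cases j <;> simp [J0]
  have hJJ : J0 * J0 = -1 := by
    ext i j; fin_cases i <;> fin_cases j <;> simp [J0, Matrix.mul_apply, Fin.sum_univ_four]
  have hcomm : H * J0 = J0 * H := by
    have h1 : J0 * (J0ᵀ * H * J0) = J0 * H := by rw [hHJ]
    rw [hJT] at h1
    rw [← h1]
    calc H * J0 = -((J0 * J0) * (H * J0)) := by rw [hJJ]; simp
      _ = _ := by noncomm_ring
  have hAJ' : A * J0 = -(J0 * A) := eq_neg_of_add_eq_zero_left hAJ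
  rw [hA, hJT] at hc
  have key : A * H + J0 * P = H * A + P * J0 := by
    have h2 : ((-A * H + -J0 * P) * J0 + -J0 * H * A) * J0 = P * J0 := by rw [hc]
    have h3 : J0 * H * A * J0 = H * A := by
      rw [← hcomm, mul_assoc, hAJ', mul_neg, mul_assoc H, ← mul_assoc J0, hJJ]; simp
    have h4 : ((-A * H + -J0 * P) * J0 + -J0 * H * A) * J0
        = -((A * H + J0 * P) * (J0 * J0)) - J0 * H * A * J0 := by noncomm_ring
    rw [h4, h3, hJJ] at h2
    rw [← h2]; simp
  have hT : (A * H + J0 * P)ᵀ = -(A * H + J0 * P) := by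
    conv_rhs => rw [key]
    rw [Matrix.transpose_add, Matrix.transpose_mul, Matrix.transpose_mul, hA, hH, hP, hJT]
    simp [add_comm]
  have hT2 : (J0 * H * A)ᵀ = A * H * J0 := by
    rw [Matrix.transpose_mul, Matrix.transpose_mul, hA, hH, hJT]
    simp [mul_assoc]
  have hd : ∀ i, 2 * (A * H * J0ᵀ) i i + (J0 * P * J0ᵀ) i i = P i i := by
    intro i
    have h5 : (J0 * H * A) i i = (A * H * J0) i i := by rw [← hT2]; rfl
    have h6 := congrFun (congrFun hc i) i
    rw [hJT]
    simp only [neg_mul, mul_neg, Matrix.add_mul, Matrix.add_apply, Matrix.neg_apply] at h6 ⊢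
    linarith
  refine ⟨fun i => ?_, ?_, ?_⟩
  · have := congrFun (congrFun hT i) i
    simp only [Matrix.transpose_apply, Matrix.neg_apply] at this
    linarith
  · have h7 := hd 0
    have h8 : (J0 * P * J0ᵀ) 0 0 = P 2 2 := by
      simp [J0, Matrix.mul_apply, Matrix.vecMul, dotProduct, Fin.sum_univ_four]
    linarith
  · have h7 := hd 1
    have h8 : (J0 * P * J0ᵀ) 1 1 = P 3 3 := by
      simp [J0, Matrix.mul_apply, Matrix.vecMul, dotProduct, Fin.sum_univ_four]
    linarith

/-- First-order expansion of `tr(M⁻¹N)` where `M(0) = 1`, `N(0)` is diagonal and the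
derivative of `M` has zero diagonal. -/
theorem trace_HD {k : Fin 4} {M N : (Fin 4 → ℝ) → Matrix (Fin 2) (Fin 2) ℂ}
    {M' N' : Matrix (Fin 2) (Fin 2) ℂ} (hM : ∀ i j, HD k (fun x => M x i j) (M' i j))
    (hN : ∀ i j, HD k (fun x => N x i j) (N' i j)) (hM0 : M 0 = 1)
    (hN0 : ∀ i j, i ≠ j → N 0 i j = 0) (hM' : ∀ i, M' i i = 0) :
    HD k (fun x => ((M x)⁻¹ * N x).trace) (N' 0 0 + N' 1 1) := by
  have h := HD.sum fun i => HD.sum fun j => (HD.inv hM (by rw [hM0]; exact isUnit_one) i j).mul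
    (hN j i)
  have h01 := hN0 0 1 (by decide)
  have h10 := hN0 1 0 (by decide)
  simp only [hM0, inv_one, one_mul, mul_one, Fin.sum_univ_two, hM', h01, h10] at h
  have e1 : (fun x => ((M x)⁻¹ * N x).trace) = fun x => (M x)⁻¹ 0 0 * N x 0 0 +
      (M x)⁻¹ 0 1 * N x 1 0 + ((M x)⁻¹ 1 0 * N x 0 1 + (M x)⁻¹ 1 1 * N x 1 1) := by
    funext x
    simp [Matrix.trace, Matrix.mul_apply, Fin.sum_univ_two]
  rw [e1]
  refine h.cast (fun _ => rfl) ?_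
  simp

/-- Derivative of a Hermitian component. -/
theorem comp_HD {k : Fin 4} {J m : (Fin 4 → ℝ) → Matrix (Fin 4) (Fin 4) ℝ}
    {A P : Matrix (Fin 4) (Fin 4) ℝ} (hJ : ∀ i j, HD k (fun x => J x i j) (A i j))
    (hm : ∀ i j, HD k (fun x => m x i j) (P i j)) (a b : Fin 4) :
    HD k (fun x => (1 / 2 : ℂ) * ((m x a b : ℂ) - Complex.I * ((∑ l, J x a l * m x l b : ℝ) : ℂ)))
      ((1 / 2 : ℂ) * ((P a b : ℂ) - Complex.I * (((A * m 0 + J 0 * P) a b : ℝ) : ℂ))) := by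
  have h1 := (HD.sum fun l => (hJ a l).mul (hm l b)).ofReal
  have h2 := (HD.const (k := k) (1 / 2 : ℂ)).mul
    ((hm a b).ofReal.sub ((HD.const (k := k) Complex.I).mul h1))
  refine h2.cast (fun _ => rfl) ?_
  simp [Matrix.mul_apply, Finset.sum_add_distrib]

theorem mul_HD {k : Fin 4} {M N : (Fin 4 → ℝ) → Matrix (Fin 4) (Fin 4) ℝ}
    {A P : Matrix (Fin 4) (Fin 4) ℝ} (hM : ∀ i j, HD k (fun x => M x i j) (A i j))
    (hN : ∀ i j, HD k (fun x => N x i j) (P i j)) (a b : Fin 4) :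
    HD k (fun x => (M x * N x) a b) ((A * N 0 + M 0 * P) a b) := by
  have h1 := HD.sum fun l => (hM a l).mul (hN l b)
  simpa [Matrix.mul_apply, Finset.sum_add_distrib] using h1

theorem eq_of_HD {k : Fin 4} {M N : (Fin 4 → ℝ) → Matrix (Fin 4) (Fin 4) ℝ}
    {A P : Matrix (Fin 4) (Fin 4) ℝ} (hM : ∀ i j, HD k (fun x => M x i j) (A i j))
    (hN : ∀ i j, HD k (fun x => N x i j) (P i j)) (h : ∀ x, M x = N x) : A = P := by
  obtain rfl : M = N := funext h
  ext i j
  exact (hM i j).unique (hN i j)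

/-- Lemma 3.4: in coordinates centred at `0` where `g(0) = 2·I₄`, the first
derivatives of `g` vanish at `0`, `J(0) = J₀` and `G'(0)` is diagonal, the
Hermitian component matrices `G, G', G̃, G̃'` of the `J`-compatible metrics
`g, g'` satisfy: `G` and `G̃` are invertible near `0`, and at `0`, for
`γ ∈ {1,2}`, `2 D_γ(tr(G⁻¹G')) = 2 Σ (G(0)⁻¹)_{βα} D_γ G'_{αβ}(0)
= D_γ(Σ g^{ij} g'_{ij}) + E_γ` and `2 D_γ(tr(G̃⁻¹G̃')) = D_γ(Σ g^{ij} g'_{ij}) − E_γ`,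
where `E_γ = Σ_{i=1}^2 Σ_{r,s} g'_{rs}(0) (D_γ J_i{}^r)(0) J_i{}^s(0)`. -/
theorem lemma_3_4
    (J g g' : (Fin 4 → ℝ) → Matrix (Fin 4) (Fin 4) ℝ)
    (hJC1 : ∀ i j, ContDiff ℝ 1 (fun x => J x i j))
    (hgC1 : ∀ i j, ContDiff ℝ 1 (fun x => g x i j))
    (hg'C1 : ∀ i j, ContDiff ℝ 1 (fun x => g' x i j))
    (hJ2 : ∀ x, J x * J x = -1)
    (hgsymm : ∀ x, (g x).IsSymm)
    (hg'symm : ∀ x, (g' x).IsSymm)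
    (hJg : ∀ x, (J x)ᵀ * g x * J x = g x)
    (hJg' : ∀ x, (J x)ᵀ * g' x * J x = g' x)
    (hg0 : g 0 = (2 : ℝ) • (1 : Matrix (Fin 4) (Fin 4) ℝ))
    (hdg0 : ∀ k i j, pdR k (fun x => g x i j) 0 = 0)
    (hJat0 : J 0 = J0)
    (Jl J' : (Fin 4 → ℝ) → Matrix (Fin 4) (Fin 4) ℝ)
    (hJl : ∀ x i j, Jl x i j = ∑ k, J x i k * g x k j)
    (hJ'def : ∀ x i j, J' x i j = ∑ k, J x i k * g' x k j)
    (G G' Gt Gt' : (Fin 4 → ℝ) → Matrix (Fin 2) (Fin 2) ℂ)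
    (hG : ∀ x α β, G x α β = (1 / 2) *
      ((g x (emb α) (emb β) : ℂ) - Complex.I * (Jl x (emb α) (emb β) : ℂ)))
    (hG' : ∀ x α β, G' x α β = (1 / 2) *
      ((g' x (emb α) (emb β) : ℂ) - Complex.I * (J' x (emb α) (emb β) : ℂ)))
    (hGt : ∀ x α β, Gt x α β = (1 / 2) *
      ((g x (embA α) (embA β) : ℂ) - Complex.I * (Jl x (embA α) (embA β) : ℂ)))
    (hGt' : ∀ x α β, Gt' x α β = (1 / 2) *
      ((g' x (embA α) (embA β) : ℂ) - Complex.I * (J' x (embA α) (embA β) : ℂ)))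
    (hdiag : ∀ α β : Fin 2, α ≠ β → G' 0 α β = 0)
    (E : Fin 2 → ℂ)
    (hE : ∀ γ, E γ = ∑ i : Fin 2, ∑ r, ∑ s, (g' 0 r s : ℂ)
      * Dop J (emb γ) (fun x => ((J x (emb i) r : ℝ) : ℂ)) 0
      * (J 0 (emb i) s : ℂ)) :
    (∃ V ∈ nhds (0 : Fin 4 → ℝ), ∀ x ∈ V, IsUnit (G x).det ∧ IsUnit (Gt x).det)
    ∧ ∀ γ : Fin 2,
      (2 * Dop J (emb γ) (fun x => ((G x)⁻¹ * G' x).trace) 0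
        = 2 * ∑ α, ∑ β, (G 0)⁻¹ β α * Dop J (emb γ) (fun x => G' x α β) 0)
      ∧ (2 * ∑ α, ∑ β, (G 0)⁻¹ β α * Dop J (emb γ) (fun x => G' x α β) 0
        = Dop J (emb γ)
            (fun x => ((∑ i, ∑ j, (g x)⁻¹ i j * g' x i j : ℝ) : ℂ)) 0 + E γ)
      ∧ (2 * Dop J (emb γ) (fun x => ((Gt x)⁻¹ * Gt' x).trace) 0
        = Dop J (emb γ)
            (fun x => ((∑ i, ∑ j, (g x)⁻¹ i j * g' x i j : ℝ) : ℂ)) 0 - E γ) := by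
  
  have hG0 : G 0 = 1 := by
    ext i j
    rw [hG, hJl, hg0, hJat0]
    fin_cases i <;> fin_cases j <;> simp [emb, J0, Fin.sum_univ_four, Matrix.one_apply]
  have hGt0 : Gt 0 = 1 := by
    ext i j
    rw [hGt, hJl, hg0, hJat0]
    fin_cases i <;> fin_cases j <;> simp [embA, J0, Fin.sum_univ_four, Matrix.one_apply]
  have hHJ : J0ᵀ * g' 0 * J0 = g' 0 := by rw [← hJat0]; exact hJg' 0
  have hH : (g' 0)ᵀ = g' 0 := hg'symm 0
  have hdiagt : ∀ α β : Fin 2, α ≠ β → Gt' 0 α β = 0 := by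
    have hs : ∀ i j, g' 0 i j = g' 0 j i := fun i j => (hg'symm 0).apply j i
    have hq : ∀ i j, (J0ᵀ * g' 0 * J0) i j = g' 0 i j := fun i j => by rw [hHJ]
    have q1 := hq 0 1
    have q2 := hq 1 0
    have q3 := hq 1 2
    have q4 := hq 0 3
    have d1 := hdiag 0 1 (by decide)
    have d2 := hdiag 1 0 (by decide)
    have s1 := hs 3 0
    have s2 := hs 2 1
    rw [hG', hJ'def, hJat0] at d1 d2
    simp [emb, J0, Fin.sum_univ_four, Matrix.mul_apply, Complex.ext_iff] at q1 q2 q3 q4 d1 d2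
    intro α β hab
    rw [hGt', hJ'def, hJat0]
    fin_cases α <;> fin_cases β <;> simp [embA, J0, Fin.sum_univ_four, Complex.ext_iff] at hab ⊢ <;>
      constructor <;> linarith [d1.1, d1.2, d2.1, d2.2]
  have hcont : ∀ (F : (Fin 4 → ℝ) → Matrix (Fin 2) (Fin 2) ℂ) (e : Fin 2 → Fin 4),
      (∀ x α β, F x α β = (1 / 2) *
        ((g x (e α) (e β) : ℂ) - Complex.I * (Jl x (e α) (e β) : ℂ))) → F 0 = 1 →
      ∀ᶠ x in nhds (0 : Fin 4 → ℝ), IsUnit (F x).det := by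
    intro F e hF hF0
    have hc : Continuous F := by
      refine continuous_matrix fun α β => ?_
      simp only [hF, hJl]
      have := fun i j => (hJC1 i j).continuous
      have := fun i j => (hgC1 i j).continuous
      fun_prop
    have hne : (F 0).det ≠ 0 := by rw [hF0]; simp
    filter_upwards [hc.matrix_det.continuousAt.eventually_ne hne] with x hx
    exact isUnit_iff_ne_zero.mpr hx
  refine ⟨⟨_, (hcont G emb hG hG0).and (hcont Gt embA hGt hGt0), fun x hx => hx⟩, fun γ => ?_⟩
  -- derivative in direction `k`
  have main : ∀ k : Fin 4,
      pdC k (fun x => ((G x)⁻¹ * G' x).trace) 0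
        = ∑ α, ∑ β, (G 0)⁻¹ β α * pdC k (fun x => G' x α β) 0
      ∧ 2 * ∑ α, ∑ β, (G 0)⁻¹ β α * pdC k (fun x => G' x α β) 0
        = pdC k (fun x => ((∑ i, ∑ j, (g x)⁻¹ i j * g' x i j : ℝ) : ℂ)) 0
          + ∑ i : Fin 2, ∑ r, ∑ s, (g' 0 r s : ℂ)
            * pdC k (fun x => ((J x (emb i) r : ℝ) : ℂ)) 0 * (J 0 (emb i) s : ℂ)
      ∧ 2 * pdC k (fun x => ((Gt x)⁻¹ * Gt' x).trace) 0
        = pdC k (fun x => ((∑ i, ∑ j, (g x)⁻¹ i j * g' x i j : ℝ) : ℂ)) 0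
          - ∑ i : Fin 2, ∑ r, ∑ s, (g' 0 r s : ℂ)
            * pdC k (fun x => ((J x (emb i) r : ℝ) : ℂ)) 0 * (J 0 (emb i) s : ℂ) := by
    intro k
    obtain ⟨A, hA⟩ : ∃ A : Matrix (Fin 4) (Fin 4) ℝ, ∀ i j, HD k (fun x => J x i j) (A i j) :=
      ⟨Matrix.of fun i j => pdR k (fun x => J x i j) 0, fun i j => HD.of_contDiff (hJC1 i j)⟩
    obtain ⟨P, hP⟩ : ∃ A : Matrix (Fin 4) (Fin 4) ℝ, ∀ i j, HD k (fun x => g' x i j) (A i j) :=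
      ⟨Matrix.of fun i j => pdR k (fun x => g' x i j) 0, fun i j => HD.of_contDiff (hg'C1 i j)⟩
    have hg : ∀ i j, HD k (fun x => g x i j) ((0 : Matrix (Fin 4) (Fin 4) ℝ) i j) := fun i j => by
      have := HD.of_contDiff (k := k) (hgC1 i j)
      rwa [hdg0] at this
    have hAT : ∀ i j, HD k (fun x => (J x)ᵀ i j) (Aᵀ i j) := fun i j => hA j i
    have hconst : ∀ i j, HD k (fun _ : Fin 4 → ℝ => (-1 : Matrix (Fin 4) (Fin 4) ℝ) i j)
        ((0 : Matrix (Fin 4) (Fin 4) ℝ) i j) := fun i j => HD.const _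
    have hPs : Pᵀ = P := eq_of_HD (fun i j => hP j i) hP hg'symm
    have e1 := eq_of_HD (mul_HD hA hA) hconst hJ2
    have e2 := eq_of_HD (mul_HD (mul_HD hAT hg) hA) hg hJg
    have e3 := eq_of_HD (mul_HD (mul_HD hAT hP) hA) hP hJg'
    rw [hJat0] at e1 e2 e3
    have hJT : J0ᵀ = -J0 := by
      ext i j; fin_cases i <;> fin_cases j <;> simp [J0]
    have hJJ : J0 * J0 = -1 := by
      ext i j; fin_cases i <;> fin_cases j <;> simp [J0, Matrix.mul_apply, Fin.sum_univ_four]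
    have hAs : Aᵀ = -A := by
      rw [hg0, hJT] at e2
      have e4 : Aᵀ * J0 = J0 * A := by
        have : (2 : ℝ) • (Aᵀ * J0 - J0 * A) = 0 := by
          rw [← e2]
          simp [smul_sub, sub_eq_add_neg]
        have := (smul_eq_zero.mp this).resolve_left (by norm_num)
        exact sub_eq_zero.mp this
      have e5 : J0 * A = -(A * J0) := eq_neg_of_add_eq_zero_right e1
      have e6 : Aᵀ * J0 * J0 = -(A * J0) * J0 := by rw [e4, e5]
      rw [neg_mul, mul_assoc, mul_assoc, hJJ] at e6
      simpa using congrArg (fun M => -M) e6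
    obtain ⟨c1, c2, c3⟩ := alg_core A (g' 0) P hAs hH hPs e1 hHJ e3
    have hAd : ∀ i, A i i = 0 := fun i => by
      have := congrFun (congrFun hAs i) i
      simp only [Matrix.transpose_apply, Matrix.neg_apply] at this
      linarith
    -- the Hermitian components
    have hGd : ∀ α β, HD k (fun x => G x α β) ((Matrix.of fun α β : Fin 2 => (1 / 2 : ℂ) *
        ((0 : ℂ) - Complex.I * (((A * g 0 + J 0 * (0 : Matrix (Fin 4) (Fin 4) ℝ)) (emb α) (emb β) : ℝ) : ℂ))) α β) := by
      intro α β
      have := comp_HD hA hg (emb α) (emb β)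
      simpa only [hG, hJl, Matrix.of_apply, Matrix.zero_apply, Complex.ofReal_zero] using this
    have hGtd : ∀ α β, HD k (fun x => Gt x α β) ((Matrix.of fun α β : Fin 2 => (1 / 2 : ℂ) *
        ((0 : ℂ) - Complex.I * (((A * g 0 + J 0 * (0 : Matrix (Fin 4) (Fin 4) ℝ)) (embA α) (embA β) : ℝ) : ℂ))) α β) := by
      intro α β
      have := comp_HD hA hg (embA α) (embA β)
      simpa only [hGt, hJl, Matrix.of_apply, Matrix.zero_apply, Complex.ofReal_zero] using this
    have hG'd : ∀ α β, HD k (fun x => G' x α β) ((Matrix.of fun α β : Fin 2 => (1 / 2 : ℂ) *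
        ((P (emb α) (emb β) : ℂ) - Complex.I *
          (((A * g' 0 + J 0 * P) (emb α) (emb β) : ℝ) : ℂ))) α β) := by
      intro α β
      have := comp_HD hA hP (emb α) (emb β)
      simpa only [hG', hJ'def, Matrix.of_apply] using this
    have hGt'd : ∀ α β, HD k (fun x => Gt' x α β) ((Matrix.of fun α β : Fin 2 => (1 / 2 : ℂ) *
        ((P (embA α) (embA β) : ℂ) - Complex.I *
          (((A * g' 0 + J 0 * P) (embA α) (embA β) : ℝ) : ℂ))) α β) := by
      intro α β
      have := comp_HD hA hP (embA α) (embA β)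
      simpa only [hGt', hJ'def, Matrix.of_apply] using this
    have t1 := trace_HD hGd hG'd hG0 hdiag (fun i => by
      simp only [Matrix.of_apply, hg0, mul_zero, add_zero, Matrix.mul_smul, mul_one,
        Matrix.smul_apply, hAd]
      simp)
    have t2 := trace_HD hGtd hGt'd hGt0 hdiagt (fun i => by
      simp only [Matrix.of_apply, hg0, mul_zero, add_zero, Matrix.mul_smul, mul_one,
        Matrix.smul_apply, hAd]
      simp)
    have hg0u : IsUnit (g 0) := by
      rw [hg0, Matrix.isUnit_iff_isUnit_det, Matrix.det_smul]
      simp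
    have hg0i : (g 0)⁻¹ = (1 / 2 : ℝ) • (1 : Matrix (Fin 4) (Fin 4) ℝ) := by
      refine Matrix.inv_eq_right_inv ?_
      rw [hg0]
      simp
    have t3 := (HD.sum fun i => HD.sum fun j => (HD.inv hg hg0u i j).mul (hP i j)).ofReal
    have t3' : HD k (fun x => ((∑ i, ∑ j, (g x)⁻¹ i j * g' x i j : ℝ) : ℂ))
        (((1 / 2) * (P 0 0 + P 1 1 + P 2 2 + P 3 3) : ℝ) : ℂ) := by
      convert t3 using 2
      rw [hg0i]
      simp [Fin.sum_univ_four, Matrix.one_apply]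
      ring
    have hsum : ∑ α, ∑ β, (G 0)⁻¹ β α * pdC k (fun x => G' x α β) 0
        = pdC k (fun x => G' x 0 0) 0 + pdC k (fun x => G' x 1 1) 0 := by
      rw [hG0]
      simp [Fin.sum_univ_two]
    have hEk : ∑ i : Fin 2, ∑ r, ∑ s, (g' 0 r s : ℂ)
            * pdC k (fun x => ((J x (emb i) r : ℝ) : ℂ)) 0 * (J 0 (emb i) s : ℂ)
        = (((A * g' 0 * J0ᵀ) 0 0 + (A * g' 0 * J0ᵀ) 1 1 : ℝ) : ℂ) := by
      simp only [(hA _ _).ofReal.pdC, hJat0]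
      have : (∑ i : Fin 2, ∑ r, ∑ s, g' 0 r s * A (emb i) r * J0 (emb i) s)
          = (A * g' 0 * J0ᵀ) 0 0 + (A * g' 0 * J0ᵀ) 1 1 := by
        simp [Matrix.mul_apply, Fin.sum_univ_two, Fin.sum_univ_four, emb, J0]
        ring
      rw [← this]
      push_cast
      rfl
    rw [hsum, hEk, t3'.pdC, t1.pdC, t2.pdC, (hG'd 0 0).pdC, (hG'd 1 1).pdC]
    rw [hJat0]
    simp only [Matrix.of_apply, c1]
    have ee0 : emb 0 = 0 := rfl
    have ee1 : emb 1 = 1 := rfl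
    have ea0 : embA 0 = 2 := rfl
    have ea1 : embA 1 = 3 := rfl
    have c2' : (P 0 0 : ℂ) - P 2 2 = 2 * ((A * g' 0 * J0ᵀ) 0 0 : ℝ) := by exact_mod_cast c2
    have c3' : (P 1 1 : ℂ) - P 3 3 = 2 * ((A * g' 0 * J0ᵀ) 1 1 : ℝ) := by exact_mod_cast c3
    rw [ee0, ee1, ea0, ea1]
    refine ⟨trivial, ?_, ?_⟩
    · push_cast
      linear_combination (1 / 2 : ℂ) * c2' + (1 / 2 : ℂ) * c3'
    · push_cast
      linear_combination (-1 / 2 : ℂ) * c2' - (1 / 2 : ℂ) * c3'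
  obtain ⟨c, hc⟩ := Dop_eq_sum J (emb γ)
  have hswap : ∑ α, ∑ β, (G 0)⁻¹ β α * Dop J (emb γ) (fun x => G' x α β) 0
      = ∑ k, c k * ∑ α, ∑ β, (G 0)⁻¹ β α * pdC k (fun x => G' x α β) 0 := by
    simp only [hc, Fin.sum_univ_two, Fin.sum_univ_four]
    ring
  have hEswap : E γ = ∑ k, c k * ∑ i : Fin 2, ∑ r, ∑ s, (g' 0 r s : ℂ)
            * pdC k (fun x => ((J x (emb i) r : ℝ) : ℂ)) 0 * (J 0 (emb i) s : ℂ) := by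
    rw [hE]
    simp only [Finset.mul_sum]
    refine Eq.trans ?_ Finset.sum_comm
    refine Finset.sum_congr rfl fun i _ => ?_
    refine Eq.trans ?_ Finset.sum_comm
    refine Finset.sum_congr rfl fun r _ => ?_
    refine Eq.trans ?_ Finset.sum_comm
    refine Finset.sum_congr rfl fun s _ => ?_
    rw [hc, Finset.mul_sum, Finset.sum_mul]
    refine Finset.sum_congr rfl fun k _ => ?_
    ring
  rw [hswap, hEswap]
  simp only [hc]
  refine ⟨?_, ?_, ?_⟩
  · simp only [(main _).1]
  · rw [Finset.mul_sum, ← Finset.sum_add_distrib]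
    refine Finset.sum_congr rfl fun k _ => ?_
    linear_combination c k * (main k).2.1
  · rw [Finset.mul_sum, ← Finset.sum_sub_distrib]
    refine Finset.sum_congr rfl fun k _ => ?_
    linear_combination c k * (main k).2.2
end

section
/- Let g be a real symmetric positive definite 4×4 matrix, J a real 4×4 matrix with J·J = −I₄ and JᵀgJ = g, and g′ a real symmetric 4×4 matrix with Jᵀg′J = g′. Write J_i{}^j for the entries of J, g^{ij} for the entries of g⁻¹, and set J′_{ij} = Σ_k J_i{}^k g′_{kj}. Let S = (S_{pi}{}^j) be a family of real numbers indexed by triples in {1,2,3,4} satisfying: (H0) Σ_k (S_{pi}{}^k J_k{}^j + J_i{}^k S_{pk}{}^j) = 0 for all p,i,j; (H1) the lowered array S_{pij} := Σ_k S_{pi}{}^k g_{kj} satisfies S_{pij} = −S_{pji} for all p,i,j and S_{ijk} + S_{jki} + S_{kij} = 0 for all i,j,k; (H3) Σ_i S_{ij}{}^i = 0 for every j. Define a_{γij} = Σ_k [(S_{iγ}{}^k − S_{γi}{}^k) J′_{kj} + S_{jγ}{}^k J′_{ik} − S_{ji}{}^k J′_{γk}] and b_{γij} = Σ_k [g′_{ki}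 S_{jγ}{}^k − g′_{kγ} S_{ji}{}^k] + Σ_{k,l} J′_{jl} (J_i{}^k S_{kγ}{}^l − J_γ{}^k S_{ki}{}^l). Then for every γ ∈ {1,2,3,4}: Σ_{i,j} g^{ij} a_{γij} = 0 and Σ_{i,j} g^{ij} b_{γij} = 0. -/
open Matrix

/-- Skew 4×4 matrix with self-dual part `a` and anti-self-dual part `b`. -/
def skewQ (a b : Fin 3 → ℝ) : Matrix (Fin 4) (Fin 4) ℝ :=
  !![0, a 0 + b 0, a 1 + b 1, a 2 + b 2;
     -(a 0 + b 0), 0, a 2 - b 2, b 1 - a 1;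
     -(a 1 + b 1), -(a 2 - b 2), 0, a 0 - b 0;
     -(a 2 + b 2), -(b 1 - a 1), -(a 0 - b 0), 0]

lemma exists_skewQ (X : Matrix (Fin 4) (Fin 4) ℝ) (h : Xᵀ = -X) :
    ∃ a b, X = skewQ a b := by
  have e : ∀ i j, X j i = - X i j := fun i j => congrFun (congrFun h i) j
  refine ⟨![(X 0 1 + X 2 3)/2, (X 0 2 - X 1 3)/2, (X 0 3 + X 1 2)/2],
    ![(X 0 1 - X 2 3)/2, (X 0 2 + X 1 3)/2, (X 0 3 - X 1 2)/2], ?_⟩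
  ext i j
  fin_cases i <;> fin_cases j <;> simp [skewQ] <;>
    linarith [e 0 0, e 1 1, e 2 2, e 3 3, e 0 1, e 0 2, e 0 3, e 1 2, e 1 3, e 2 3]

lemma skewQ_anti (s t a b : Fin 3 → ℝ)
    (h : skewQ s t * skewQ a b + skewQ a b * skewQ s t = 0) :
    (∀ i j, s i * b j + a i * t j = 0) ∧
    s 0 * a 0 + s 1 * a 1 + s 2 * a 2 + (t 0 * b 0 + t 1 * b 1 + t 2 * b 2) = 0 := by
  have e : ∀ i j, (skewQ s t * skewQ a b + skewQ a b * skewQ s t) i j = 0 := by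
    intro i j; rw [h]; rfl
  have e00 := e 0 0
  have e11 := e 1 1
  have e22 := e 2 2
  have e33 := e 3 3
  have e01 := e 0 1
  have e02 := e 0 2
  have e03 := e 0 3
  have e12 := e 1 2
  have e13 := e 1 3
  have e23 := e 2 3
  simp [skewQ, Matrix.mul_apply, Fin.sum_univ_four] at e00 e11 e22 e33 e01 e02 e03 e12 e13 e23
  refine ⟨fun i j => ?_, by linarith⟩
  fin_cases i <;> fin_cases j <;> simp <;> linarith

lemma skewQ_det (a b : Fin 3 → ℝ) : (skewQ a b).det =
    ((a 0 ^ 2 + a 1 ^ 2 + a 2 ^ 2) - (b 0 ^ 2 + b 1 ^ 2 + b 2 ^ 2)) ^ 2 := by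
  simp [skewQ, Matrix.det_succ_row_zero, Fin.sum_univ_succ, Fin.succAbove]
  ring

lemma skewQ_smul (c : ℝ) (a b : Fin 3 → ℝ) : skewQ (c • a) (c • b) = c • skewQ a b := by
  ext i j
  fin_cases i <;> fin_cases j <;> simp [skewQ] <;> ring

lemma skewQ_transpose (a b : Fin 3 → ℝ) : (skewQ a b)ᵀ = - skewQ a b := by
  ext i j
  fin_cases i <;> fin_cases j <;> simp [skewQ]

/-- coefficients of a symmetric matrix in the basis of products. -/
def nco (N : Matrix (Fin 4) (Fin 4) ℝ) : Fin 3 → Fin 3 → ℝ := fun i j =>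
  (N * (skewQ (Pi.single i 1) 0 * skewQ 0 (Pi.single j 1))).trace

lemma nco_zero (N : Matrix (Fin 4) (Fin 4) ℝ) (h : Nᵀ = N) (ht : N.trace = 0)
    (h0 : ∀ i j, nco N i j = 0) : N = 0 := by
  have e : ∀ i j, N j i = N i j := fun i j => congrFun (congrFun h i) j
  have a00 := h0 0 0
  have a01 := h0 0 1
  have a02 := h0 0 2
  have a10 := h0 1 0
  have a11 := h0 1 1
  have a12 := h0 1 2
  have a20 := h0 2 0
  have a21 := h0 2 1
  have a22 := h0 2 2
  simp [nco, skewQ, Matrix.trace, Matrix.mul_apply, Fin.sum_univ_four]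
    at ht a00 a01 a02 a10 a11 a12 a20 a21 a22
  ext i j
  fin_cases i <;> fin_cases j <;> simp <;>
    linarith [e 0 1, e 0 2, e 0 3, e 1 2, e 1 3, e 2 3]

lemma nco_left (N : Matrix (Fin 4) (Fin 4) ℝ) (h : Nᵀ = N) (s : Fin 3 → ℝ)
    (hs : skewQ s 0 * N + N * skewQ s 0 = 0) (j : Fin 3) :
    s 0 * nco N 0 j + s 1 * nco N 1 j + s 2 * nco N 2 j = 0 := by
  have e : ∀ i j, N j i = N i j := fun i j => congrFun (congrFun h i) j
  have q : ((skewQ s 0 * N + N * skewQ s 0) * skewQ 0 (Pi.single j 1)).trace = 0 := by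
    rw [hs]; simp
  have e10 := e 0 1
  have e20 := e 0 2
  have e30 := e 0 3
  have e21 := e 1 2
  have e31 := e 1 3
  have e32 := e 2 3
  fin_cases j <;>
  · simp [nco, skewQ, Matrix.trace, Matrix.mul_apply, Fin.sum_univ_four, Matrix.vecMul,
      dotProduct, e10, e20, e30, e21, e31, e32] at q ⊢
    linarith

lemma nco_right (N : Matrix (Fin 4) (Fin 4) ℝ) (h : Nᵀ = N) (s : Fin 3 → ℝ)
    (hs : skewQ 0 s * N + N * skewQ 0 s = 0) (j : Fin 3) :
    s 0 * nco N j 0 + s 1 * nco N j 1 + s 2 * nco N j 2 = 0 := by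
  have e : ∀ i j, N j i = N i j := fun i j => congrFun (congrFun h i) j
  have q : ((skewQ 0 s * N + N * skewQ 0 s) * skewQ (Pi.single j 1) 0).trace = 0 := by
    rw [hs]; simp
  have e10 := e 0 1
  have e20 := e 0 2
  have e30 := e 0 3
  have e21 := e 1 2
  have e31 := e 1 3
  have e32 := e 2 3
  fin_cases j <;>
  · simp [nco, skewQ, Matrix.trace, Matrix.mul_apply, Fin.sum_univ_four, Matrix.vecMul,
      dotProduct, e10, e20, e30, e21, e31, e32] at q ⊢
    linarith

lemma sq3_pos (u : Fin 3 → ℝ) (h : u ≠ 0) : 0 < u 0 ^ 2 + u 1 ^ 2 + u 2 ^ 2 := by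
  by_contra hc
  apply h
  have h0 : u 0 = 0 := by nlinarith [sq_nonneg (u 0), sq_nonneg (u 1), sq_nonneg (u 2)]
  have h1 : u 1 = 0 := by nlinarith [sq_nonneg (u 0), sq_nonneg (u 1), sq_nonneg (u 2)]
  have h2 : u 2 = 0 := by nlinarith [sq_nonneg (u 0), sq_nonneg (u 1), sq_nonneg (u 2)]
  ext i; fin_cases i <;> simp [h0, h1, h2]

/-- the line orthogonal to two independent orthogonal vectors -/
lemma line3 (a u : Fin 3 → ℝ) (ha : a ≠ 0) (hu : u ≠ 0)
    (h : a 0 * u 0 + a 1 * u 1 + a 2 * u 2 = 0) :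
    ∃ w : Fin 3 → ℝ, w ≠ 0 ∧ ∀ s : Fin 3 → ℝ, s 0 * a 0 + s 1 * a 1 + s 2 * a 2 = 0 →
      s 0 * u 0 + s 1 * u 1 + s 2 * u 2 = 0 → ∃ c : ℝ, s = c • w := by
  have pa := sq3_pos a ha
  have pu := sq3_pos u hu
  set w : Fin 3 → ℝ := ![a 1 * u 2 - a 2 * u 1, a 2 * u 0 - a 0 * u 2, a 0 * u 1 - a 1 * u 0] with hw
  have w0 : w 0 = a 1 * u 2 - a 2 * u 1 := rfl
  have w1 : w 1 = a 2 * u 0 - a 0 * u 2 := rfl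
  have w2 : w 2 = a 0 * u 1 - a 1 * u 0 := rfl
  have hn : w 0 ^ 2 + w 1 ^ 2 + w 2 ^ 2 =
      (a 0 ^ 2 + a 1 ^ 2 + a 2 ^ 2) * (u 0 ^ 2 + u 1 ^ 2 + u 2 ^ 2) := by
    rw [w0, w1, w2]
    linear_combination (-(a 0 * u 0 + a 1 * u 1 + a 2 * u 2)) * h
  have pw : 0 < w 0 ^ 2 + w 1 ^ 2 + w 2 ^ 2 := by rw [hn]; positivity
  refine ⟨w, ?_, fun s h1 h2 => ⟨(s 0 * w 0 + s 1 * w 1 + s 2 * w 2) /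
      (w 0 ^ 2 + w 1 ^ 2 + w 2 ^ 2), ?_⟩⟩
  · intro h0
    rw [h0] at pw
    simp at pw
  · -- s × w = (s·u) a - (s·a) u = 0
    have c0 : s 1 * w 2 - s 2 * w 1 = 0 := by
      rw [w1, w2]; linear_combination a 0 * h2 - u 0 * h1
    have c1 : s 2 * w 0 - s 0 * w 2 = 0 := by
      rw [w0, w2]; linear_combination a 1 * h2 - u 1 * h1
    have c2 : s 0 * w 1 - s 1 * w 0 = 0 := by
      rw [w0, w1]; linear_combination a 2 * h2 - u 2 * h1
    ext i
    have pw' := pw.ne'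
    clear_value w
    fin_cases i <;> simp <;> field_simp
    · linear_combination w 1 * c2 - w 2 * c1
    · linear_combination w 2 * c0 - w 0 * c2
    · linear_combination w 0 * c1 - w 1 * c0

/-- The key dichotomy. -/
lemma key_line (M : Matrix (Fin 4) (Fin 4) ℝ) (hM : M * M = -1) (hns : Mᵀ ≠ -M) :
    ∃ W : Matrix (Fin 4) (Fin 4) ℝ, Wᵀ = -W ∧ W.det ≠ 0 ∧
      ∀ S : Matrix (Fin 4) (Fin 4) ℝ, Sᵀ = -S → S * M + M * S = 0 → ∃ c : ℝ, S = c • W := by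
  obtain ⟨K, hK⟩ : ∃ K, K = M - Mᵀ := ⟨_, rfl⟩
  obtain ⟨N, hN⟩ : ∃ N, N = M + Mᵀ := ⟨_, rfl⟩
  have hKs : Kᵀ = -K := by rw [hK]; simp
  have hNs : Nᵀ = N := by rw [hN]; simp [add_comm]
  have hM' : Mᵀ * Mᵀ = -1 := by rw [← Matrix.transpose_mul, hM]; simp
  have hKN : K * N + N * K = 0 := by
    rw [hK, hN]
    have : (M - Mᵀ) * (M + Mᵀ) + (M + Mᵀ) * (M - Mᵀ) = 2 • (M * M) - 2 • (Mᵀ * Mᵀ) := by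
      noncomm_ring
    rw [this, hM, hM']; simp
  have hKK : K * K + N * N = -(4 : ℝ) • 1 := by
    rw [hK, hN]
    have : (M - Mᵀ) * (M - Mᵀ) + (M + Mᵀ) * (M + Mᵀ) = (2:ℝ) • (M * M) + (2:ℝ) • (Mᵀ * Mᵀ) := by
      rw [two_smul, two_smul]
      noncomm_ring
    rw [this, hM, hM']; module
  have hdet : K.det ≠ 0 := by
    intro h0
    obtain ⟨x, hx, hKx⟩ := Matrix.exists_mulVec_eq_zero_iff.mpr h0
    have h1 : (K * K + N * N) *ᵥ x = (-(4:ℝ) • (1 : Matrix (Fin 4) (Fin 4) ℝ)) *ᵥ x := by rw [hKK]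
    rw [Matrix.add_mulVec, ← Matrix.mulVec_mulVec, hKx, Matrix.mulVec_zero, zero_add,
      ← Matrix.mulVec_mulVec, Matrix.smul_mulVec, Matrix.one_mulVec] at h1
    have h2 : x ⬝ᵥ (N *ᵥ (N *ᵥ x)) = -4 * (x ⬝ᵥ x) := by rw [h1]; simp
    rw [Matrix.dotProduct_mulVec, ← Matrix.mulVec_transpose, hNs] at h2
    have h3 : 0 ≤ (N *ᵥ x) ⬝ᵥ (N *ᵥ x) := Finset.sum_nonneg fun i _ => mul_self_nonneg _
    have h4 : 0 ≤ x ⬝ᵥ x := Finset.sum_nonneg fun i _ => mul_self_nonneg _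
    exact hx (dotProduct_self_eq_zero.mp (by linarith))
  have htr : N.trace = 0 := by
    have hu : IsUnit K.det := isUnit_iff_ne_zero.mpr hdet
    have h1 : N = - (K * N * K⁻¹) := by
      have h2 : K * N = - (N * K) := eq_neg_of_add_eq_zero_left hKN
      rw [h2, Matrix.neg_mul, neg_neg, Matrix.mul_nonsing_inv_cancel_right _ _ hu]
    have h3 : N.trace = - N.trace := by
      conv_lhs => rw [h1]
      rw [Matrix.trace_neg, Matrix.trace_mul_comm, Matrix.nonsing_inv_mul_cancel_left _ _ hu]
    linarith
  have hN0 : N ≠ 0 := by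
    intro h; apply hns; rw [h] at hN; exact eq_neg_of_add_eq_zero_right hN.symm
  have hS : ∀ S : Matrix (Fin 4) (Fin 4) ℝ, Sᵀ = -S → S * M + M * S = 0 →
      S * K + K * S = 0 ∧ S * N + N * S = 0 := by
    intro S hs h
    have h' : S * Mᵀ + Mᵀ * S = 0 := by
      have := congrArg Matrix.transpose h
      rw [Matrix.transpose_add, Matrix.transpose_mul, Matrix.transpose_mul, hs] at this
      have h2 : S * Mᵀ + Mᵀ * S = -(Mᵀ * -S + -S * Mᵀ) := by noncomm_ring
      rw [h2, this]; simp
    constructor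
    · rw [hK]
      have : S * (M - Mᵀ) + (M - Mᵀ) * S = (S * M + M * S) - (S * Mᵀ + Mᵀ * S) := by noncomm_ring
      rw [this, h, h']; simp
    · rw [hN]
      have : S * (M + Mᵀ) + (M + Mᵀ) * S = (S * M + M * S) + (S * Mᵀ + Mᵀ * S) := by noncomm_ring
      rw [this, h, h']; simp
  clear hKK hM' hM hns
  obtain ⟨a, b, hab⟩ := exists_skewQ K hKs
  have hd := hdet
  rw [hab, skewQ_det] at hd
  have hd' := (pow_ne_zero_iff two_ne_zero).mp hd
  -- orthogonality
  have hst : ∀ s t : Fin 3 → ℝ, skewQ s t * K + K * skewQ s t = 0 →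
      (s 0 * a 0 + s 1 * a 1 + s 2 * a 2 = 0) ∧ (t 0 * b 0 + t 1 * b 1 + t 2 * b 2 = 0) ∧
      (b ≠ 0 → s = 0) ∧ (a ≠ 0 → t = 0) := by
    intro s t h
    rw [hab] at h
    obtain ⟨h1, h2⟩ := skewQ_anti s t a b h
    have h3 : s 0 * a 0 + s 1 * a 1 + s 2 * a 2 = 0 := by
      have : ((a 0 ^ 2 + a 1 ^ 2 + a 2 ^ 2) - (b 0 ^ 2 + b 1 ^ 2 + b 2 ^ 2)) *
          (s 0 * a 0 + s 1 * a 1 + s 2 * a 2) = 0 := by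
        linear_combination (a 0 ^ 2 + a 1 ^ 2 + a 2 ^ 2) * h2
          - a 0 * b 0 * h1 0 0 - a 0 * b 1 * h1 0 1 - a 0 * b 2 * h1 0 2
          - a 1 * b 0 * h1 1 0 - a 1 * b 1 * h1 1 1 - a 1 * b 2 * h1 1 2
          - a 2 * b 0 * h1 2 0 - a 2 * b 1 * h1 2 1 - a 2 * b 2 * h1 2 2
      exact (mul_eq_zero.mp this).resolve_left hd'
    have h4 : t 0 * b 0 + t 1 * b 1 + t 2 * b 2 = 0 := by linarith
    refine ⟨h3, h4, fun hb => ?_, fun ha => ?_⟩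
    · have pb := sq3_pos b hb
      ext i
      have : (b 0 ^ 2 + b 1 ^ 2 + b 2 ^ 2) * s i = 0 := by
        linear_combination b 0 * h1 i 0 + b 1 * h1 i 1 + b 2 * h1 i 2 - a i * h4
      exact (mul_eq_zero.mp this).resolve_left pb.ne'
    · have pa := sq3_pos a ha
      ext i
      have : (a 0 ^ 2 + a 1 ^ 2 + a 2 ^ 2) * t i = 0 := by
        linear_combination a 0 * h1 0 i + a 1 * h1 1 i + a 2 * h1 2 i - b i * h3
      exact (mul_eq_zero.mp this).resolve_left pa.ne'
  obtain ⟨i₀, j₀, hij⟩ : ∃ i j, nco N i j ≠ 0 := by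
    by_contra hc
    push Not at hc
    exact hN0 (nco_zero N hNs htr hc)
  by_cases ha : a = 0
  · have hb : b ≠ 0 := by
      rintro rfl; apply hd'; simp [ha]
    subst ha
    rw [hab] at hKN
    obtain ⟨w, hw, hl⟩ := line3 b (fun j => nco N i₀ j) hb (fun h => hij (congrFun h j₀))
      (nco_right N hNs b hKN i₀)
    refine ⟨skewQ 0 w, skewQ_transpose _ _, ?_, fun S hs h => ?_⟩
    · rw [skewQ_det]; have := sq3_pos w hw; simp; intro h; linarith
    · obtain ⟨hk, hn⟩ := hS S hs h
      obtain ⟨s, t, rfl⟩ := exists_skewQ S hs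
      obtain ⟨q1, q2, q3, q4⟩ := hst s t hk
      obtain rfl := q3 hb
      obtain ⟨c, rfl⟩ := hl t q2 (nco_right N hNs t hn i₀)
      exact ⟨c, by rw [← skewQ_smul]; simp⟩
  · by_cases hb : b = 0
    · subst hb
      rw [hab] at hKN
      obtain ⟨w, hw, hl⟩ := line3 a (fun i => nco N i j₀) ha (fun h => hij (congrFun h i₀))
        (nco_left N hNs a hKN j₀)
      refine ⟨skewQ w 0, skewQ_transpose _ _, ?_, fun S hs h => ?_⟩
      · rw [skewQ_det]; have := sq3_pos w hw; simp; exact this.ne'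
      · obtain ⟨hk, hn⟩ := hS S hs h
        obtain ⟨s, t, rfl⟩ := exists_skewQ S hs
        obtain ⟨q1, q2, q3, q4⟩ := hst s t hk
        obtain rfl := q4 ha
        obtain ⟨c, rfl⟩ := hl s q1 (nco_left N hNs s hn j₀)
        exact ⟨c, by rw [← skewQ_smul]; simp⟩
    · refine ⟨K, hKs, hdet, fun S hs h => ⟨0, ?_⟩⟩
      obtain ⟨hk, hn⟩ := hS S hs h
      obtain ⟨s, t, rfl⟩ := exists_skewQ S hs
      obtain ⟨q1, q2, q3, q4⟩ := hst s t hk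
      rw [q3 hb, q4 ha, hab, ← skewQ_smul]
      simp

/-- `v ∧ B = 0` with `B` nondegenerate forces `v = 0`. -/
lemma wedge_zero (B : Matrix (Fin 4) (Fin 4) ℝ) (hB : Bᵀ = -B) (hd : B.det ≠ 0)
    (v : Fin 4 → ℝ) (h : ∀ i j k, v i * B j k + v j * B k i + v k * B i j = 0) : v = 0 := by
  obtain ⟨a, b, rfl⟩ := exists_skewQ B hB
  rw [skewQ_det] at hd
  have hd' := (pow_ne_zero_iff two_ne_zero).mp hd
  have h012 := h 0 1 2
  have h013 := h 0 1 3
  have h023 := h 0 2 3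
  have h123 := h 1 2 3
  simp [skewQ] at h012 h013 h023 h123
  ext i
  refine (mul_eq_zero.mp (?_ : _ * v i = 0)).resolve_left hd'
  fin_cases i
  · show _ * v 0 = 0
    linear_combination (a 0 + b 0) * h023 - (a 1 + b 1) * h013 + (a 2 + b 2) * h012
  · show _ * v 1 = 0
    linear_combination (a 0 + b 0) * h123 - (a 2 - b 2) * h013 + (b 1 - a 1) * h012
  · show _ * v 2 = 0
    linear_combination (a 1 + b 1) * h123 - (a 2 - b 2) * h023 + (a 0 - b 0) * h012
  · show _ * v 3 = 0
    linear_combination (a 2 + b 2) * h123 - (b 1 - a 1) * h023 + (a 0 - b 0) * h013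

open scoped MatrixOrder in
lemma exists_factor (g : Matrix (Fin 4) (Fin 4) ℝ) (hg : g.PosDef) :
    ∃ B : Matrix (Fin 4) (Fin 4) ℝ, g = Bᴴ * B :=
  CStarAlgebra.nonneg_iff_eq_star_mul_self.mp hg.posSemidef.nonneg

lemma dichotomy (g J : Matrix (Fin 4) (Fin 4) ℝ) (hg : g.PosDef) (hJ2 : J * J = -1)
    (S : Fin 4 → Matrix (Fin 4) (Fin 4) ℝ) (H0 : ∀ p, S p * J + J * S p = 0)
    (H1a : ∀ p, (S p * g)ᵀ = -(S p * g))
    (H1b : ∀ i j k, (S i * g) j k + (S j * g) k i + (S k * g) i j = 0) :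
    (J * g)ᵀ = -(J * g) ∨ ∀ p, S p = 0 := by
  obtain ⟨B, hB⟩ := exists_factor g hg
  obtain ⟨P, hP⟩ : ∃ P, P = Bᵀ := ⟨_, rfl⟩
  have hgP : g = P * Pᵀ := by
    rw [hB, hP, Matrix.conjTranspose_eq_transpose_of_trivial, Matrix.transpose_transpose]
  have hPd : IsUnit P.det := by
    have := hg.det_pos
    rw [hgP, Matrix.det_mul, Matrix.det_transpose] at this
    exact isUnit_iff_ne_zero.mpr (fun h => by simp [h] at this)
  have i1 : P * P⁻¹ = 1 := Matrix.mul_nonsing_inv _ hPd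
  have i2 : P⁻¹ * P = 1 := Matrix.nonsing_inv_mul _ hPd
  have i3 : Pᵀ * P⁻¹ᵀ = 1 := by rw [← Matrix.transpose_mul, i2, Matrix.transpose_one]
  have i4 : P⁻¹ᵀ * Pᵀ = 1 := by rw [← Matrix.transpose_mul, i1, Matrix.transpose_one]
  generalize P⁻¹ = R at i1 i2 i3 i4
  have hM2 : (R * J * P) * (R * J * P) = -1 := by
    calc (R * J * P) * (R * J * P) = R * J * (P * R) * J * P := by noncomm_ring
      _ = R * (J * J) * P := by rw [i1]; noncomm_ring
      _ = -1 := by rw [hJ2]; simp [i2]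
  have hconj : ∀ X : Matrix (Fin 4) (Fin 4) ℝ, R * X * P = R * (X * g) * Rᵀ := by
    intro X
    rw [hgP]
    calc R * X * P = R * X * P * (Pᵀ * Rᵀ) := by rw [i3]; simp
      _ = _ := by noncomm_ring
  have hback : ∀ X : Matrix (Fin 4) (Fin 4) ℝ, X * g = P * (R * X * P) * Pᵀ := by
    intro X
    rw [hgP]
    calc X * (P * Pᵀ) = (P * R) * X * (P * Pᵀ) := by rw [i1]; simp
      _ = _ := by noncomm_ring
  by_cases hs : (R * J * P)ᵀ = -(R * J * P)
  · left
    rw [hback J, Matrix.transpose_mul, Matrix.transpose_mul, hs]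
    simp [Matrix.mul_assoc]
  right
  obtain ⟨W, hW, hWd, hl⟩ := key_line _ hM2 hs
  have hc : ∀ p, ∃ c : ℝ, R * S p * P = c • W := by
    intro p
    apply hl
    · rw [hconj, Matrix.transpose_mul, Matrix.transpose_mul, H1a]
      simp [Matrix.mul_assoc]
    · calc R * S p * P * (R * J * P) + R * J * P * (R * S p * P)
          = R * S p * (P * R) * J * P + R * J * (P * R) * S p * P := by noncomm_ring
        _ = R * (S p * J + J * S p) * P := by rw [i1]; noncomm_ring
        _ = 0 := by rw [H0]; simp
  choose v hv using hc
  have hA : ∀ p, S p * g = v p • (P * W * Pᵀ) := by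
    intro p; rw [hback, hv]; simp
  have hv0 : v = 0 := by
    apply wedge_zero (P * W * Pᵀ)
    · rw [Matrix.transpose_mul, Matrix.transpose_mul, hW]; simp [Matrix.mul_assoc]
    · rw [Matrix.det_mul, Matrix.det_mul, Matrix.det_transpose]
      exact mul_ne_zero (mul_ne_zero hPd.ne_zero hWd) hPd.ne_zero
    · intro i j k
      have := H1b i j k
      rw [hA, hA, hA] at this
      simpa using this
  intro p
  have h1 := hv p
  rw [hv0] at h1
  calc S p = (P * R) * S p * (P * R) := by rw [i1]; simp
    _ = P * (R * S p * P) * R := by noncomm_ring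
    _ = 0 := by rw [h1]; simp

lemma comm_of_skew (g J : Matrix (Fin 4) (Fin 4) ℝ) (hg : g.PosDef) (hs : gᵀ = g)
    (h1 : (J * g)ᵀ = -(J * g)) (h2 : Jᵀ * g = -(g * J)) : J * g = g * J := by
  rw [Matrix.transpose_mul, hs] at h1
  obtain ⟨X, hX⟩ : ∃ X, X = g * J - J * g := ⟨_, rfl⟩
  have hXt : Xᵀ = -X := by
    rw [hX, Matrix.transpose_sub, Matrix.transpose_mul, Matrix.transpose_mul, hs, h1, h2]
    noncomm_ring
  have hgX : g * X = -(X * g) := by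
    have : g * (g * J) = J * g * g := by
      calc g * (g * J) = - (g * (Jᵀ * g)) := by rw [h2]; simp
        _ = -((g * Jᵀ) * g) := by noncomm_ring
        _ = _ := by rw [h1]; simp
    rw [hX, Matrix.mul_sub, Matrix.sub_mul, this]
    noncomm_ring
  -- traces
  have hps := hg.posSemidef
  have e1 : 0 ≤ (Xᵀ * g * X).trace := (hps.conjTranspose_mul_mul_same X).trace_nonneg
  have e3 : (Xᵀ * g * X).trace = 0 := by
    have : (Xᵀ * g * X).trace = - (Xᵀ * g * X).trace := by
      calc (Xᵀ * g * X).trace = (Xᵀ * (g * X)).trace := by rw [Matrix.mul_assoc]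
        _ = (X * (X * g)).trace := by rw [hgX, hXt]; simp
        _ = ((X * g) * X).trace := Matrix.trace_mul_comm _ _
        _ = _ := by rw [hXt]; simp
    linarith
  have e4 : X = 0 := by
    by_contra hne
    have : Xᵀ * g * X = 0 := (hps.conjTranspose_mul_mul_same X).trace_eq_zero_iff.mp e3
    apply hne
    ext i j
    have hx : X.col j = 0 := by
      by_contra hx
      have h5 := hg.dotProduct_mulVec_pos hx
      have h6 : (Xᵀ * g * X) j j = 0 := by rw [this]; rfl
      have h7 : star (X.col j) ⬝ᵥ g *ᵥ X.col j = (Xᵀ * g * X) j j := by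
        rw [Matrix.mul_assoc, Matrix.mul_apply]
        simp [dotProduct, Matrix.mulVec, Matrix.mul_apply]
      rw [h7, h6] at h5
      exact lt_irrefl _ h5
    exact congrFun hx i
  rw [e4] at hX
  exact (sub_eq_zero.mp hX.symm).symm

section proper

/-- `Σ_k J_{pk} S_k = J S_p`. -/
lemma quasi (g J : Matrix (Fin 4) (Fin 4) ℝ) (hgu : IsUnit g.det) (hJ2 : J * J = -1)
    (hJt : Jᵀ = -J) (hc : J * g = g * J)
    (S : Fin 4 → Matrix (Fin 4) (Fin 4) ℝ) (H0 : ∀ p, S p * J + J * S p = 0)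
    (H1b : ∀ i j k, (S i * g) j k + (S j * g) k i + (S k * g) i j = 0) (p : Fin 4) :
    ∑ k, J p k • S k = J * S p := by
  obtain ⟨A, hA⟩ : ∃ A : Fin 4 → Matrix (Fin 4) (Fin 4) ℝ, A = fun p => S p * g := ⟨_, rfl⟩
  have hAJ : ∀ p, J * A p * J = A p := by
    intro p
    have : J * S p = -(S p * J) := eq_neg_of_add_eq_zero_right (H0 p)
    calc J * A p * J = (J * S p) * (g * J) := by rw [hA]; noncomm_ring
      _ = -(S p * (J * J) * g) := by rw [← hc, this]; noncomm_ring
      _ = A p := by rw [hJ2, hA]; simp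
  have hAJ2 : ∀ p, J * A p = - (A p * J) := by
    intro p
    calc J * A p = - (J * A p * (J * J)) := by rw [hJ2]; simp
      _ = -((J * A p * J) * J) := by noncomm_ring
      _ = _ := by rw [hAJ]
  have T : ∀ x y z : Fin 4 → ℝ, (∑ i, ∑ j, ∑ k, x i * y j * z k * A i j k)
      + (∑ i, ∑ j, ∑ k, y i * z j * x k * A i j k)
      + (∑ i, ∑ j, ∑ k, z i * x j * y k * A i j k) = 0 := by
    intro x y z
    have e1 : (∑ i, ∑ j, ∑ k, y i * z j * x k * A i j k) =
        ∑ i, ∑ j, ∑ k, x i * y j * z k * A j k i := by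
      rw [Finset.sum_comm_cycle]
      refine Finset.sum_congr rfl fun i _ => Finset.sum_congr rfl fun j _ =>
        Finset.sum_congr rfl fun k _ => by ring
    have e2 : (∑ i, ∑ j, ∑ k, z i * x j * y k * A i j k) =
        ∑ i, ∑ j, ∑ k, x i * y j * z k * A k i j := by
      rw [← Finset.sum_comm_cycle]
      refine Finset.sum_congr rfl fun i _ => Finset.sum_congr rfl fun j _ =>
        Finset.sum_congr rfl fun k _ => by ring
    rw [e1, e2]
    simp only [← Finset.sum_add_distrib]
    refine Finset.sum_eq_zero fun i _ => Finset.sum_eq_zero fun j _ =>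
        Finset.sum_eq_zero fun k _ => ?_
    have := H1b i j k
    rw [hA]
    linear_combination (x i * y j * z k) * this
  -- the trilinear form
  obtain ⟨F, hF⟩ : ∃ F : (Fin 4 → ℝ) → (Fin 4 → ℝ) → (Fin 4 → ℝ) → ℝ,
      ∀ x y z, F x y z = ∑ i, ∑ j, ∑ k, x i * y j * z k * A i j k := ⟨_, fun _ _ _ => rfl⟩
  have hF' : ∀ x y z, F x y z = ∑ i, x i * (y ⬝ᵥ A i *ᵥ z) := by
    intro x y z
    rw [hF]
    simp only [dotProduct, Matrix.mulVec, Finset.mul_sum]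
    refine Finset.sum_congr rfl fun i _ => Finset.sum_congr rfl fun j _ =>
        Finset.sum_congr rfl fun k _ => by ring
  simp only [← hF] at T
  have FJ : ∀ x y z, F x (y ᵥ* J) z = F x y (z ᵥ* J) := by
    intro x y z
    rw [hF', hF']
    refine Finset.sum_congr rfl fun i _ => ?_
    rw [← Matrix.mulVec_transpose J z, hJt, ← Matrix.dotProduct_mulVec, Matrix.mulVec_mulVec,
      Matrix.mulVec_mulVec, hAJ2, Matrix.mul_neg]
  have JJ : ∀ y : Fin 4 → ℝ, (y ᵥ* J) ᵥ* J = -y := by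
    intro y; rw [Matrix.vecMul_vecMul, hJ2, Matrix.vecMul_neg, Matrix.vecMul_one]
  have Fneg : ∀ x y z, F x y (-z) = - F x y z := by
    intro x y z; rw [hF', hF']; simp [Matrix.mulVec_neg]
  have FJJ : ∀ x y z, F x (y ᵥ* J) (z ᵥ* J) = - F x y z := by
    intro x y z; rw [FJ, JJ, Fneg]
  have main : ∀ x y z, F (x ᵥ* J) (y ᵥ* J) z = - F x y z := by
    intro x y z
    have t1 := T x y z
    have t2 := T x (y ᵥ* J) (z ᵥ* J)
    have t3 := T (x ᵥ* J) (y ᵥ* J) z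
    have t4 := T (x ᵥ* J) y (z ᵥ* J)
    rw [FJJ] at t2 t3 t4
    have r1 := FJ (y ᵥ* J) z x
    have r2 := FJ (z ᵥ* J) x y
    have r3 := FJ (x ᵥ* J) y z
    linarith
  have hB : J * (∑ k, J p k • A k) = - A p := by
    ext i j
    have := main (Pi.single p 1) (Pi.single i 1) (Pi.single j 1)
    rw [hF', hF'] at this
    simp [Pi.single_apply, Matrix.single_one_vecMul] at this
    rw [Matrix.neg_apply, ← this, Matrix.mul_sum, Matrix.sum_apply]
    refine Finset.sum_congr rfl fun k _ => ?_
    simp [Matrix.mul_apply, dotProduct, Finset.mul_sum, mul_left_comm]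
  have hB2 : (∑ k, J p k • A k) = J * A p := by
    calc (∑ k, J p k • A k) = -((J * J) * ∑ k, J p k • A k) := by rw [hJ2]; simp
      _ = - (J * (J * (∑ k, J p k • A k))) := by rw [Matrix.mul_assoc]
      _ = _ := by rw [hB]; simp
  have hB3 : (∑ k, J p k • S k) * g = (J * S p) * g := by
    rw [Finset.sum_mul]
    simp only [hA] at hB2
    rw [Matrix.mul_assoc, ← hB2]
    simp
  have := congrArg (· * g⁻¹) hB3
  simpa [Matrix.mul_nonsing_inv_cancel_right _ _ hgu] using this

lemma trace_anti (X J R : Matrix (Fin 4) (Fin 4) ℝ) (h : X * J + J * X = 0)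
    (hR : R * J = J * R) : (X * (J * R)).trace = 0 := by
  have h' : X * J = -(J * X) := eq_neg_of_add_eq_zero_left h
  have : (X * (J * R)).trace = - (X * (J * R)).trace := by
    calc (X * (J * R)).trace = ((X * J) * R).trace := by rw [Matrix.mul_assoc]
      _ = -(J * (X * R)).trace := by rw [h']; simp [Matrix.mul_assoc]
      _ = -((X * R) * J).trace := by rw [Matrix.trace_mul_comm]
      _ = _ := by rw [Matrix.mul_assoc, hR]
  linarith

lemma contr_zero (J R : Matrix (Fin 4) (Fin 4) ℝ) (hJ2 : J * J = -1) (hJt : Jᵀ = -J)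
    (hR : R * J = J * R)
    (S : Fin 4 → Matrix (Fin 4) (Fin 4) ℝ) (H0 : ∀ p, S p * J + J * S p = 0)
    (hq : ∀ p, ∑ k, J p k • S k = J * S p) (c : Fin 4) :
    ∑ k, ∑ l, R k l * S k c l = 0 := by
  have hRJ : R = Jᵀ * R * J := by
    rw [hJt, Matrix.mul_assoc, hR, ← Matrix.mul_assoc, Matrix.neg_mul, hJ2]; simp
  have hJS : ∀ p, J * S p * Jᵀ = - S p := by
    intro p
    have : J * S p = -(S p * J) := eq_neg_of_add_eq_zero_right (H0 p)
    rw [this, hJt, Matrix.neg_mul, Matrix.mul_neg, Matrix.mul_assoc, hJ2]; simp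
  have e : ∑ k, ∑ l, R k l * S k c l = ∑ p, ∑ q, R p q * (J * S p * Jᵀ) c q := by
    conv_lhs => rw [hRJ]
    have l1 : ∀ k l, (Jᵀ * R * J) k l * S k c l =
        ∑ p, ∑ q, R p q * (J p k * S k c l * J q l) := by
      intro k l
      rw [Matrix.mul_assoc, Matrix.mul_apply, Finset.sum_mul]
      refine Finset.sum_congr rfl fun p _ => ?_
      rw [Matrix.mul_apply, Finset.mul_sum, Finset.sum_mul]
      refine Finset.sum_congr rfl fun q _ => ?_
      rw [Matrix.transpose_apply]; ring
    have l2 : ∀ p q, R p q * (J * S p * Jᵀ) c q =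
        ∑ k, ∑ l, R p q * (J p k * S k c l * J q l) := by
      intro p q
      rw [← hq, Finset.sum_mul, Matrix.sum_apply, Finset.mul_sum]
      refine Finset.sum_congr rfl fun k _ => ?_
      rw [Matrix.mul_apply, Finset.mul_sum]
      refine Finset.sum_congr rfl fun l _ => ?_
      simp
    simp only [l1, l2]
    calc _ = ∑ k, ∑ p, ∑ l, ∑ q, R p q * (J p k * S k c l * J q l) :=
          Finset.sum_congr rfl fun k _ => Finset.sum_comm
      _ = ∑ k, ∑ p, ∑ q, ∑ l, R p q * (J p k * S k c l * J q l) :=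
          Finset.sum_congr rfl fun k _ => Finset.sum_congr rfl fun p _ => Finset.sum_comm
      _ = ∑ p, ∑ k, ∑ q, ∑ l, R p q * (J p k * S k c l * J q l) := Finset.sum_comm
      _ = _ := Finset.sum_congr rfl fun p _ => Finset.sum_comm
  have e2 : ∑ p, ∑ q, R p q * (J * S p * Jᵀ) c q = - ∑ k, ∑ l, R k l * S k c l := by
    simp [hJS]
  linarith

/-- `g^{ij} S_{ji}^k = 0`. -/
lemma div_zero' (g : Matrix (Fin 4) (Fin 4) ℝ) (hgu : IsUnit g.det) (hs : gᵀ = g)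
    (S : Fin 4 → Matrix (Fin 4) (Fin 4) ℝ)
    (H1a : ∀ p, (S p * g)ᵀ = -(S p * g)) (H3 : ∀ j, ∑ i, S i j i = 0) (k : Fin 4) :
    ∑ i, ∑ j, g⁻¹ i j * S j i k = 0 := by
  have hh : g⁻¹ᵀ = g⁻¹ := by rw [Matrix.transpose_nonsing_inv, hs]
  have e : ∀ j, g⁻¹ * S j = -((S j)ᵀ * g⁻¹) := by
    intro j
    have h1 := H1a j
    rw [Matrix.transpose_mul, hs] at h1
    calc g⁻¹ * S j = g⁻¹ * (S j * g) * g⁻¹ := by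
          rw [Matrix.mul_assoc, Matrix.mul_nonsing_inv_cancel_right _ _ hgu]
      _ = -(g⁻¹ * (g * (S j)ᵀ) * g⁻¹) := by rw [h1]; simp
      _ = _ := by rw [Matrix.nonsing_inv_mul_cancel_left _ _ hgu]
  have e1 : ∀ j, ∑ i, g⁻¹ i j * S j i k = - ∑ m, S j m j * g⁻¹ m k := by
    intro j
    have h1 := congrFun (congrFun (e j) j) k
    rw [Matrix.neg_apply, Matrix.mul_apply, Matrix.mul_apply] at h1
    simp only [Matrix.transpose_apply] at h1
    rw [← h1]
    refine Finset.sum_congr rfl fun i _ => ?_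
    rw [← hh, Matrix.transpose_apply, hh]
  rw [Finset.sum_comm]
  simp only [e1]
  rw [Finset.sum_neg_distrib, Finset.sum_comm]
  simp only [← Finset.sum_mul, H3]
  simp

end proper



/-- The algebraic content of Lemma 3.5, at a single point of an almost-Kähler
4-manifold.  Here `J` is a `g`-compatible linear almost complex structure, `g'` a
second `J`-compatible symmetric matrix, and `S p i j` represents `∇_p J_i{}^j`.
Under (H0) (derivative of `J² = −I`), (H1) (antisymmetry of `∇_p J_{ij}` and
`dω = 0`) and (H3) (harmonicity `∇_i J_j{}^i = 0`), the `g`-traces of the tensors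
`a_{γij}` and `b_{γij}` of Lemma 3.3 vanish. -/
theorem lemma_3_5_algebraic
    (g J g' : Matrix (Fin 4) (Fin 4) ℝ)
    (hg_symm : g.IsSymm) (hg_pos : g.PosDef)
    (hJ2 : J * J = -1)
    (hJg : Jᵀ * g * J = g)
    (hg'_symm : g'.IsSymm)
    (hJg' : Jᵀ * g' * J = g')
    (J' : Matrix (Fin 4) (Fin 4) ℝ)
    (hJ' : ∀ i j, J' i j = ∑ k, J i k * g' k j)
    (S : Fin 4 → Fin 4 → Fin 4 → ℝ)
    (H0 : ∀ p i j, ∑ k, (S p i k * J k j + J i k * S p k j) = 0)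
    (Slow : Fin 4 → Fin 4 → Fin 4 → ℝ)
    (hSlow : ∀ p i j, Slow p i j = ∑ k, S p i k * g k j)
    (H1a : ∀ p i j, Slow p i j = - Slow p j i)
    (H1b : ∀ i j k, Slow i j k + Slow j k i + Slow k i j = 0)
    (H3 : ∀ j, ∑ i, S i j i = 0)
    (a b : Fin 4 → Fin 4 → Fin 4 → ℝ)
    (ha : ∀ γ i j, a γ i j = ∑ k,
      ((S i γ k - S γ i k) * J' k j + S j γ k * J' i k - S j i k * J' γ k))
    (hb : ∀ γ i j, b γ i j =
      (∑ k, (g' k i * S j γ k - g' k γ * S j i k))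
      + ∑ k, ∑ l, J' j l * (J i k * S k γ l - J γ k * S k i l)) :
    ∀ γ : Fin 4,
      (∑ i, ∑ j, g⁻¹ i j * a γ i j) = 0 ∧ (∑ i, ∑ j, g⁻¹ i j * b γ i j) = 0 := by
  intro γ
  have hgu : IsUnit g.det := isUnit_iff_ne_zero.mpr hg_pos.det_pos.ne'
  have hgs : gᵀ = g := hg_symm
  have hgs' : g'ᵀ = g' := hg'_symm
  obtain ⟨T, hT⟩ : ∃ T : Fin 4 → Matrix (Fin 4) (Fin 4) ℝ, ∀ p i j, T p i j = S p i j :=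
    ⟨fun p => Matrix.of (S p), fun _ _ _ => rfl⟩
  simp only [← hT] at H0 hSlow H3 ha hb
  have hL : ∀ p i j, Slow p i j = (T p * g) i j := by
    intro p i j; rw [hSlow, Matrix.mul_apply]
  simp only [hL] at H1a H1b
  have T0 : ∀ p, T p * J + J * T p = 0 := by
    intro p; ext i j
    rw [Matrix.add_apply, Matrix.mul_apply, Matrix.mul_apply, ← Finset.sum_add_distrib, H0]; rfl
  have T1 : ∀ p, (T p * g)ᵀ = -(T p * g) := by
    intro p; ext i j
    rw [Matrix.transpose_apply, H1a]; rfl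
  rcases dichotomy g J hg_pos hJ2 T T0 T1 H1b with hsk | hz
  swap
  · simp [ha, hb, hz]
  have hJg2 : Jᵀ * g = -(g * J) := by
    calc Jᵀ * g = -(Jᵀ * g * (J * J)) := by rw [hJ2]; simp
      _ = -((Jᵀ * g * J) * J) := by noncomm_ring
      _ = _ := by rw [hJg]
  have hc := comm_of_skew g J hg_pos hgs hsk hJg2
  have hJt : Jᵀ = -J := by
    rw [← hc] at hJg2
    have := congrArg (· * g⁻¹) hJg2
    simpa [Matrix.mul_nonsing_inv_cancel_right _ _ hgu] using this
  have hh : g⁻¹ᵀ = g⁻¹ := by rw [Matrix.transpose_nonsing_inv, hgs]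
  have hhJ : g⁻¹ * J = J * g⁻¹ := by
    calc g⁻¹ * J = g⁻¹ * (J * g) * g⁻¹ := by
          rw [Matrix.mul_assoc, Matrix.mul_nonsing_inv_cancel_right _ _ hgu]
      _ = _ := by rw [hc, Matrix.nonsing_inv_mul_cancel_left _ _ hgu]
  have hc' : J * g' = g' * J := by
    rw [hJt] at hJg'
    calc J * g' = J * (-J * g' * J) := by rw [hJg']
      _ = -((J * J) * g' * J) := by noncomm_ring
      _ = _ := by rw [hJ2]; simp
  have hJ'm : J' = J * g' := by
    ext i j; rw [hJ', Matrix.mul_apply]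
  have hJ't : J'ᵀ = -J' := by
    rw [hJ'm, Matrix.transpose_mul, hJt, hgs', Matrix.mul_neg, hc']
  have hV := div_zero' g hgu hgs T T1 H3
  have hq := quasi g J hgu hJ2 hJt hc T T0 H1b
  generalize g⁻¹ = h at hh hhJ hV ⊢
  have hs1 : ∀ i j, h i j = h j i := fun i j => congrFun (congrFun hh j) i
  have hs2 : ∀ i j, g' i j = g' j i := fun i j => congrFun (congrFun hgs' j) i
  have hs3 : ∀ i j, J' i j = - J' j i := fun i j => congrFun (congrFun hJ't j) i
  have hRJ : (g' * h) * J = J * (g' * h) := by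
    rw [Matrix.mul_assoc, hhJ, ← Matrix.mul_assoc, ← hc', Matrix.mul_assoc]
  have hRJ2 : (h * g') * J = J * (h * g') := by
    rw [Matrix.mul_assoc, ← hc', ← Matrix.mul_assoc, hhJ, Matrix.mul_assoc]
  have htr : ∀ p, ∑ i, ∑ j, ∑ k, h i j * (T p i k * J' k j) = 0 := by
    intro p
    rw [← trace_anti (T p) J (g' * h) (T0 p) hRJ, ← Matrix.mul_assoc J, ← hJ'm,
      ← Matrix.mul_assoc]
    refine Finset.sum_congr rfl fun i _ => ?_
    rw [Matrix.diag_apply, Matrix.mul_apply]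
    refine Finset.sum_congr rfl fun j _ => ?_
    rw [Matrix.mul_apply, Finset.sum_mul]
    refine Finset.sum_congr rfl fun k _ => ?_
    rw [hs1 i j]; ring
  have hV2 : ∀ c : Fin 4 → ℝ, ∑ i, ∑ j, ∑ k, h i j * (T j i k * c k) = 0 := by
    intro c
    calc _ = ∑ i, ∑ k, ∑ j, h i j * (T j i k * c k) :=
          Finset.sum_congr rfl fun i _ => Finset.sum_comm
      _ = ∑ k, ∑ i, ∑ j, h i j * (T j i k * c k) := Finset.sum_comm
      _ = ∑ k, (∑ i, ∑ j, h i j * T j i k) * c k := by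
          simp only [Finset.sum_mul, mul_assoc]
      _ = 0 := by simp [hV]
  constructor
  · have t13 : ∑ i, ∑ j, ∑ k, h i j * (T i γ k * J' k j) =
        - ∑ i, ∑ j, ∑ k, h i j * (T j γ k * J' i k) := by
      rw [Finset.sum_comm, ← Finset.sum_neg_distrib]
      refine Finset.sum_congr rfl fun i _ => ?_
      rw [← Finset.sum_neg_distrib]
      refine Finset.sum_congr rfl fun j _ => ?_
      rw [← Finset.sum_neg_distrib]
      refine Finset.sum_congr rfl fun k _ => ?_
      rw [hs1 i j, hs3 k i]; ring
    have split : (∑ i, ∑ j, h i j * a γ i j) =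
        (∑ i, ∑ j, ∑ k, h i j * (T i γ k * J' k j))
        - (∑ i, ∑ j, ∑ k, h i j * (T γ i k * J' k j))
        + (∑ i, ∑ j, ∑ k, h i j * (T j γ k * J' i k))
        - ∑ i, ∑ j, ∑ k, h i j * (T j i k * J' γ k) := by
      simp only [← Finset.sum_add_distrib, ← Finset.sum_sub_distrib, ha, Finset.mul_sum]
      refine Finset.sum_congr rfl fun i _ => Finset.sum_congr rfl fun j _ =>
        Finset.sum_congr rfl fun k _ => by ring
    rw [split, t13, htr, hV2]; ring
  · have hX := contr_zero J (h * g') hJ2 hJt hRJ2 T T0 hq γ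
    have u1 : ∑ i, ∑ j, ∑ k, h i j * (g' k i * T j γ k) = 0 := by
      rw [← hX, Finset.sum_comm]
      refine Finset.sum_congr rfl fun j _ => ?_
      rw [Finset.sum_comm]
      refine Finset.sum_congr rfl fun k _ => ?_
      rw [Matrix.mul_apply, Finset.sum_mul]
      refine Finset.sum_congr rfl fun i _ => ?_
      rw [hs1 i j, hs2 k i]; ring
    have u3 : ∑ i, ∑ j, ∑ k, ∑ l, h i j * (J' j l * (J i k * T k γ l)) = 0 := by
      have hR3 : h * g' = Jᵀ * (h * J') := by
        rw [hJ'm, ← Matrix.mul_assoc h, hhJ, hJt, Matrix.mul_assoc, ← Matrix.mul_assoc,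
          Matrix.neg_mul, hJ2]; simp
      rw [← hX, hR3]
      have l1 : ∀ k l, (Jᵀ * (h * J')) k l * T k γ l =
          ∑ i, ∑ j, h i j * (J' j l * (J i k * T k γ l)) := by
        intro k l
        rw [Matrix.mul_apply, Finset.sum_mul]
        refine Finset.sum_congr rfl fun p _ => ?_
        rw [Matrix.mul_apply, Finset.mul_sum, Finset.sum_mul]
        refine Finset.sum_congr rfl fun q _ => ?_
        rw [Matrix.transpose_apply]; ring
      simp only [l1]
      symm
      calc _ = ∑ k, ∑ p, ∑ l, ∑ q, h p q * (J' q l * (J p k * T k γ l)) :=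
            Finset.sum_congr rfl fun k _ => Finset.sum_comm
        _ = ∑ k, ∑ p, ∑ q, ∑ l, h p q * (J' q l * (J p k * T k γ l)) :=
            Finset.sum_congr rfl fun k _ => Finset.sum_congr rfl fun p _ => Finset.sum_comm
        _ = ∑ p, ∑ k, ∑ q, ∑ l, h p q * (J' q l * (J p k * T k γ l)) := Finset.sum_comm
        _ = _ := Finset.sum_congr rfl fun p _ => Finset.sum_comm
    have u4 : ∑ i, ∑ j, ∑ k, ∑ l, h i j * (J' j l * (J γ k * T k i l)) = 0 := by
      calc _ = ∑ i, ∑ k, ∑ j, ∑ l, h i j * (J' j l * (J γ k * T k i l)) :=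
            Finset.sum_congr rfl fun i _ => Finset.sum_comm
        _ = ∑ k, ∑ i, ∑ j, ∑ l, h i j * (J' j l * (J γ k * T k i l)) := Finset.sum_comm
        _ = ∑ k, (-J γ k) * ∑ i, ∑ j, ∑ l, h i j * (T k i l * J' l j) := by
            simp only [Finset.mul_sum]
            refine Finset.sum_congr rfl fun k _ => Finset.sum_congr rfl fun i _ =>
              Finset.sum_congr rfl fun j _ => Finset.sum_congr rfl fun l _ => ?_
            rw [hs3 j l]; ring
        _ = 0 := by simp [htr]
    have split : (∑ i, ∑ j, h i j * b γ i j) =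
        (∑ i, ∑ j, ∑ k, h i j * (g' k i * T j γ k))
        - (∑ i, ∑ j, ∑ k, h i j * (T j i k * g' k γ))
        + ((∑ i, ∑ j, ∑ k, ∑ l, h i j * (J' j l * (J i k * T k γ l)))
        - ∑ i, ∑ j, ∑ k, ∑ l, h i j * (J' j l * (J γ k * T k i l))) := by
      simp only [← Finset.sum_add_distrib, ← Finset.sum_sub_distrib, hb]
      refine Finset.sum_congr rfl fun i _ => Finset.sum_congr rfl fun j _ => ?_
      rw [Finset.mul_sum]
      refine Finset.sum_congr rfl fun k _ => ?_
      rw [mul_add, Finset.mul_sum]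
      congr 1
      · ring
      · refine Finset.sum_congr rfl fun l _ => by ring
    rw [split, u1, hV2 (fun k => g' k γ), u3, u4]; ring
end

section
/- Let 0 < λ ≤ Λ be real numbers. Then there exist a natural number N ≥ 1, vectors V_ν^{(1)}, V_ν^{(2)} ∈ ℂ² for ν = 1,…,N such that for each ν the pair (V_ν^{(1)}, V_ν^{(2)}) is a basis of ℂ² consisting of unit vectors, and real constants 0 < λ* < Λ*, with the following property: every 2×2 positive definite Hermitian matrix A all of whose eigenvalues lie in the interval [λ, Λ] can be written as A = Σ_{ν=1}^{N} β_ν ( V_ν^{(1)} (V_ν^{(1)})^* + V_ν^{(2)} (V_ν^{(2)})^* ) for some real numbers β_ν with λ* ≤ β_ν ≤ Λ* for all ν, where v v^* denotes the rank-one Hermitian matrix with entries (v v^*)_{αβ} = v_α · conj(v_β). -/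
open Matrix ComplexOrder

/-- A closed ball of radius below one is in the hull of finitely many points of the open ball. -/
lemma exists_finset_hull (R : ℝ) (hR : R < 1) :
    ∃ F : Finset (EuclideanSpace ℝ (Fin 3)), (∀ x ∈ F, ‖x‖ < 1) ∧
      Metric.closedBall (0 : EuclideanSpace ℝ (Fin 3)) R ⊆ convexHull ℝ (F : Set _) := by
  classical
  have key : ∀ x : EuclideanSpace ℝ (Fin 3), x ∈ Metric.closedBall 0 R →
      ∃ G : Finset (EuclideanSpace ℝ (Fin 3)), (∀ y ∈ G, ‖y‖ < 1) ∧
        x ∈ interior (convexHull ℝ (G : Set (EuclideanSpace ℝ (Fin 3)))) := by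
    intro x hx
    have hx1 : x ∈ Metric.ball (0 : EuclideanSpace ℝ (Fin 3)) 1 := by
      simp only [Metric.mem_closedBall, Metric.mem_ball] at *
      linarith
    obtain ⟨b, hb1, hb2⟩ := exists_mem_interior_convexHull_affineBasis
      (Metric.isOpen_ball.mem_nhds hx1)
    refine ⟨Finset.univ.image b, ?_, ?_⟩
    · intro y hy
      have : y ∈ Metric.ball (0 : EuclideanSpace ℝ (Fin 3)) 1 := by
        apply hb2
        apply subset_convexHull
        simpa using hy
      simpa using this
    · simpa using hb1
  choose! G hG1 hG2 using key
  obtain ⟨t, ht1, ht2⟩ := (isCompact_closedBall (0 : EuclideanSpace ℝ (Fin 3)) R).elim_nhds_subcover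
    (fun x => interior (convexHull ℝ (G x : Set (EuclideanSpace ℝ (Fin 3)))))
    (fun x hx => isOpen_interior.mem_nhds (hG2 x hx))
  refine ⟨t.biUnion G, ?_, ?_⟩
  · intro y hy
    obtain ⟨x, hx, hy⟩ := Finset.mem_biUnion.1 hy
    exact hG1 x (ht1 x hx) y hy
  · intro y hy
    obtain ⟨x, hx, hy⟩ := Set.mem_iUnion₂.1 (ht2 hy)
    refine convexHull_mono ?_ (interior_subset hy)
    exact_mod_cast Finset.subset_biUnion_of_mem G hx

/-- The matrix with Bloch vector `r`. -/
noncomputable def bloch (r : EuclideanSpace ℝ (Fin 3)) : Matrix (Fin 2) (Fin 2) ℂ :=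
  !![((1 + r 0 : ℝ) : ℂ), (r 1 : ℂ) + (r 2 : ℂ) * Complex.I;
     (r 1 : ℂ) - (r 2 : ℂ) * Complex.I, ((1 - r 0 : ℝ) : ℂ)]

lemma norm_sq3 (r : EuclideanSpace ℝ (Fin 3)) : ‖r‖ ^ 2 = r 0 ^ 2 + r 1 ^ 2 + r 2 ^ 2 := by
  rw [EuclideanSpace.norm_sq_eq]
  simp [Fin.sum_univ_three]

lemma exists_basis (r : EuclideanSpace ℝ (Fin 3)) (hr : ‖r‖ < 1) :
    ∃ V : Fin 2 → EuclideanSpace ℂ (Fin 2), ((∀ i, ‖V i‖ = 1) ∧ LinearIndependent ℂ V ∧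
        Submodule.span ℂ (Set.range V) = ⊤) ∧
      bloch r = ∑ i : Fin 2, Matrix.of (fun α γ => V i α * (starRingEnd ℂ) (V i γ)) := by
  have hn := norm_sq3 r
  have hn1 : r 0 ^ 2 + r 1 ^ 2 + r 2 ^ 2 < 1 := by
    rw [← hn]; nlinarith [norm_nonneg r]
  have hp : 0 < 1 + r 0 := by nlinarith [sq_nonneg (r 1), sq_nonneg (r 2)]
  set c : ℝ := √((1 + r 0) / 2) with hc
  have hc2 : c ^ 2 = (1 + r 0) / 2 := Real.sq_sqrt (by linarith)
  have hc0 : 0 < c := Real.sqrt_pos.2 (by linarith)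
  -- `w` is the average of the second coordinates
  set w : ℂ := ((r 1 : ℂ) - (r 2 : ℂ) * Complex.I) / ((2 * c : ℝ) : ℂ) with hw
  have hwn : ‖w‖ ^ 2 * (4 * c ^ 2) = r 1 ^ 2 + r 2 ^ 2 := by
    rw [hw, norm_div, div_pow, Complex.norm_real, Real.norm_eq_abs, sq_abs,
      ← Complex.normSq_eq_norm_sq]
    have : Complex.normSq ((r 1 : ℂ) - (r 2 : ℂ) * Complex.I) = r 1 ^ 2 + r 2 ^ 2 := by
      simp [Complex.normSq_apply]; ring
    rw [this]; field_simp; ring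
  have hlt : ‖w‖ ^ 2 < (1 - r 0) / 2 := by
    rw [hc2] at hwn
    by_contra h
    push Not at h
    nlinarith
  set k : ℝ := √((1 - r 0) / 2 - ‖w‖ ^ 2) with hk
  have hk2 : k ^ 2 = (1 - r 0) / 2 - ‖w‖ ^ 2 := Real.sq_sqrt (by linarith)
  have hk0 : 0 < k := Real.sqrt_pos.2 (by linarith)
  obtain ⟨e, he1, he2⟩ : ∃ e : ℂ, e * (starRingEnd ℂ) e = 1 ∧ w = ‖w‖ * e := by
    refine ⟨Complex.exp (w.arg * Complex.I), ?_, (Complex.norm_mul_exp_arg_mul_I w).symm⟩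
    rw [Complex.mul_conj, Complex.normSq_eq_norm_sq, Complex.norm_exp_ofReal_mul_I]; simp
  have hcw : 2 * (c : ℂ) * w = (r 1 : ℂ) - (r 2 : ℂ) * Complex.I := by
    rw [hw]; push_cast
    have : (c : ℂ) ≠ 0 := by exact_mod_cast hc0.ne'
    field_simp
  have hcwc : 2 * (c : ℂ) * (starRingEnd ℂ) w = (r 1 : ℂ) + (r 2 : ℂ) * Complex.I := by
    have := congrArg (starRingEnd ℂ) hcw
    simpa [Complex.conj_ofNat] using this
  have hc2' : (c : ℂ) ^ 2 = (1 + r 0) / 2 := by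
    rw [← Complex.ofReal_pow, hc2]; push_cast; rfl
  have hk2' : (k : ℂ) ^ 2 = (1 - r 0) / 2 - (‖w‖ : ℂ) ^ 2 := by
    rw [← Complex.ofReal_pow, hk2]; push_cast; rfl
  have he0 : e ≠ 0 := by rintro rfl; simp at he1
  have hen : ‖e‖ = 1 := by
    rw [Complex.mul_conj, Complex.normSq_eq_norm_sq] at he1
    have : ‖e‖ ^ 2 = 1 := by exact_mod_cast he1
    nlinarith [norm_nonneg e]
  set V : Fin 2 → EuclideanSpace ℂ (Fin 2) :=
    ![!₂[(c : ℂ), e * (‖w‖ + k * Complex.I)], !₂[(c : ℂ), e * (‖w‖ - k * Complex.I)]] with hV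
  have hnorm : ∀ i, ‖V i‖ = 1 := by
    intro i
    have h2 : ‖V i‖ ^ 2 = 1 := by
      rw [EuclideanSpace.norm_sq_eq]
      fin_cases i
      · simp [hV, Fin.sum_univ_two, mul_pow, hen, hc2]
        rw [← Complex.normSq_eq_norm_sq]
        simp [Complex.normSq_apply]
        nlinarith
      · simp [hV, Fin.sum_univ_two, mul_pow, hen, hc2]
        rw [← Complex.normSq_eq_norm_sq]
        simp [Complex.normSq_apply]
        nlinarith
    nlinarith [norm_nonneg (V i)]
  have hli : LinearIndependent ℂ V := by
    rw [Fintype.linearIndependent_iff]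
    intro g hg
    rw [Fin.sum_univ_two] at hg
    have h0 := congrArg (fun v : EuclideanSpace ℂ (Fin 2) => v 0) hg
    have h1 := congrArg (fun v : EuclideanSpace ℂ (Fin 2) => v 1) hg
    simp [hV] at h0 h1
    have hcne : (c : ℂ) ≠ 0 := by exact_mod_cast hc0.ne'
    have hkne : (k : ℂ) ≠ 0 := by exact_mod_cast hk0.ne'
    have hs : g 0 + g 1 = 0 := by
      apply mul_right_cancel₀ hcne; linear_combination h0
    have h3 : g 0 = 0 := by
      have : g 0 * (2 * e * k * Complex.I) = 0 := by
        linear_combination h1 - e * (‖w‖ - k * Complex.I) * hs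
      simpa [he0, hkne] using this
    have h4 : g 1 = 0 := by simpa [h3] using hs
    intro i
    fin_cases i
    · exact h3
    · exact h4
  refine ⟨V, ⟨hnorm, hli, ?_⟩, ?_⟩
  · apply hli.span_eq_top_of_card_eq_finrank
    simp
  · have hI := Complex.I_sq
    have hwc : (starRingEnd ℂ) w = ‖w‖ * (starRingEnd ℂ) e := by
      have := congrArg (starRingEnd ℂ) he2
      simpa using this
    ext i j
    fin_cases i <;> fin_cases j <;> simp [bloch, hV, Fin.sum_univ_two]
    · linear_combination -2 * hc2'
    · linear_combination -hcwc + 2 * c * hwc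
    · linear_combination -hcw + 2 * c * he2
    · linear_combination (-2 * (‖w‖ : ℂ) ^ 2 - 2 * k ^ 2) * he1 - 2 * hk2' +
        2 * k ^ 2 * e * (starRingEnd ℂ) e * hI

/-- Every Hermitian matrix with eigenvalues in `[lam, Lam]` in Bloch coordinates. -/
lemma exists_coords (lam Lam : ℝ)
    (A : Matrix (Fin 2) (Fin 2) ℂ) (hA : A.IsHermitian)
    (h : ∀ i, lam ≤ hA.eigenvalues i ∧ hA.eigenvalues i ≤ Lam) :
    ∃ (a : ℝ) (b : EuclideanSpace ℝ (Fin 3)), lam ≤ a ∧ a ≤ Lam ∧ ‖b‖ ≤ a - lam ∧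
      A = !![((a + b 0 : ℝ) : ℂ), (b 1 : ℂ) + (b 2 : ℂ) * Complex.I;
        (b 1 : ℂ) - (b 2 : ℂ) * Complex.I, ((a - b 0 : ℝ) : ℂ)] := by
  have h00 : (starRingEnd ℂ) (A 0 0) = A 0 0 := hA.apply 0 0
  have h11 : (starRingEnd ℂ) (A 1 1) = A 1 1 := hA.apply 1 1
  have h10 : (starRingEnd ℂ) (A 0 1) = A 1 0 := hA.apply 1 0
  have e00 : (((A 0 0).re : ℝ) : ℂ) = A 0 0 := Complex.conj_eq_iff_re.1 h00
  have e11 : (((A 1 1).re : ℝ) : ℂ) = A 1 1 := Complex.conj_eq_iff_re.1 h11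
  have htr := hA.trace_eq_sum_eigenvalues
  have hdet := hA.det_eq_prod_eigenvalues
  rw [Matrix.trace_fin_two, Fin.sum_univ_two] at htr
  rw [Matrix.det_fin_two, Fin.prod_univ_two] at hdet
  set x := hA.eigenvalues 0 with hx
  set y := hA.eigenvalues 1 with hy
  have hx' := h 0
  have hy' := h 1
  rw [← hx] at hx'
  rw [← hy] at hy'
  have htr' : (A 0 0).re + (A 1 1).re = x + y := by
    have := congrArg Complex.re htr
    simpa using this
  have hdet' : (A 0 0).re * (A 1 1).re - ((A 0 1).re ^ 2 + (A 0 1).im ^ 2) = x * y := by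
    rw [← h10, ← e00, ← e11] at hdet
    have := congrArg Complex.re hdet
    simp at this
    linarith
  refine ⟨((A 0 0).re + (A 1 1).re) / 2,
    !₂[((A 0 0).re - (A 1 1).re) / 2, (A 0 1).re, (A 0 1).im], by linarith, by linarith, ?_, ?_⟩
  · apply le_of_sq_le_sq _ (by linarith)
    rw [norm_sq3]
    simp only [PiLp.toLp_apply, Matrix.cons_val]
    have : (((A 0 0).re - (A 1 1).re) / 2) ^ 2 + (A 0 1).re ^ 2 + (A 0 1).im ^ 2
      = ((x + y) / 2) ^ 2 - x * y := by
      rw [← htr', ← hdet']; ring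
    rw [this, htr']
    nlinarith
  · ext i j
    fin_cases i <;> fin_cases j <;> simp
    · rw [← e00]; simp; ring
    · rw [← h10]; apply Complex.ext <;> simp
    · rw [← e11]; simp; ring

/-- Lemma 4.1: for `0 < λ ≤ Λ` there are finitely many unit-vector bases
`(V_ν^{(1)}, V_ν^{(2)})` of `ℂ²` and constants `0 < λ* < Λ*`, depending only on
`λ` and `Λ`, such that every 2×2 positive definite Hermitian matrix with all
eigenvalues in `[λ, Λ]` can be written as
`A = Σ_ν β_ν (V_ν^{(1)} ⊗ (V_ν^{(1)})* + V_ν^{(2)} ⊗ (V_ν^{(2)})*)` with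
`λ* ≤ β_ν ≤ Λ*`. -/
theorem finite_bases_decomposition_of_posdef_hermitian
    (lam Lam : ℝ) (hlam : 0 < lam) (hlamLam : lam ≤ Lam) :
    ∃ (N : ℕ) (V : Fin N → Fin 2 → EuclideanSpace ℂ (Fin 2)) (lamS LamS : ℝ),
      1 ≤ N ∧ 0 < lamS ∧ lamS < LamS ∧
      (∀ ν : Fin N, (∀ i, ‖V ν i‖ = 1) ∧ LinearIndependent ℂ (V ν) ∧
        Submodule.span ℂ (Set.range (V ν)) = ⊤) ∧
      (∀ A : Matrix (Fin 2) (Fin 2) ℂ, ∀ hA : A.IsHermitian, A.PosDef →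
        (∀ i, lam ≤ hA.eigenvalues i ∧ hA.eigenvalues i ≤ Lam) →
        ∃ β : Fin N → ℝ, (∀ ν, lamS ≤ β ν ∧ β ν ≤ LamS) ∧
          A = ∑ ν, (β ν : ℂ) • ∑ i : Fin 2,
            Matrix.of (fun α γ => V ν i α * (starRingEnd ℂ) (V ν i γ))) := by
  have hLam : 0 < Lam := by linarith
  have hq : 0 < lam / (2 * Lam) := by positivity
  have hq1 : lam / (2 * Lam) ≤ 1 := by rw [div_le_one (by positivity)]; linarith
  obtain ⟨F, hF1, hF2⟩ := exists_finset_hull (1 - lam / (2 * Lam)) (by linarith)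
  have hFne : F.Nonempty := by
    have : (0 : EuclideanSpace ℝ (Fin 3)) ∈ convexHull ℝ (F : Set _) :=
      hF2 (by simpa using hq1)
    have := (convexHull_nonempty_iff (𝕜 := ℝ)).1 ⟨_, this⟩
    exact_mod_cast this
  have hN : 1 ≤ F.card := hFne.card_pos
  have hN0 : (0 : ℝ) < F.card := by exact_mod_cast hN
  set r : Fin F.card → EuclideanSpace ℝ (Fin 3) := fun ν => (F.equivFin.symm ν : _) with hr
  have hr1 : ∀ ν, ‖r ν‖ < 1 := fun ν => hF1 _ (F.equivFin.symm ν).2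
  have hsum : ∀ {M : Type} [AddCommMonoid M] (f : EuclideanSpace ℝ (Fin 3) → M),
      ∑ ν, f (r ν) = ∑ x ∈ F, f x := by
    intro M _ f
    rw [← Finset.sum_coe_sort F f]
    exact Equiv.sum_comp F.equivFin.symm (fun x : F => f x)
  choose V hV1 hV2 using fun ν => exists_basis (r ν) (hr1 ν)
  set ε : ℝ := lam / (4 * F.card) with hε
  have hε0 : 0 < ε := by positivity
  have hεN : F.card * ε = lam / 4 := by rw [hε]; field_simp
  refine ⟨F.card, V, ε, ε + Lam, hN, hε0, by linarith, hV1, ?_⟩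
  intro A hA _ heig
  obtain ⟨a, b, ha1, ha2, hb, hAeq⟩ := exists_coords lam Lam A hA heig
  set a' := a - lam / 4 with ha'
  have ha'0 : 0 < a' := by linarith
  set b' := b - ε • ∑ ν, r ν with hb'
  have hsr : ‖∑ ν, r ν‖ ≤ F.card := by
    refine (norm_sum_le _ _).trans ?_
    refine (Finset.sum_le_sum (fun ν _ => (hr1 ν).le)).trans ?_
    simp
  have hb'n : ‖b'‖ ≤ a' - lam / 2 := by
    refine (norm_sub_le _ _).trans ?_
    rw [norm_smul, Real.norm_of_nonneg hε0.le]
    nlinarith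
  have hmem : a'⁻¹ • b' ∈ convexHull ℝ (F : Set (EuclideanSpace ℝ (Fin 3))) := by
    apply hF2
    rw [mem_closedBall_zero_iff, norm_smul, norm_inv, Real.norm_of_nonneg ha'0.le,
      inv_mul_le_iff₀ ha'0]
    refine hb'n.trans ?_
    have : a' * (lam / (2 * Lam)) ≤ lam / 2 := by
      calc a' * (lam / (2 * Lam)) ≤ Lam * (lam / (2 * Lam)) := by
            apply mul_le_mul_of_nonneg_right (by linarith) hq.le
        _ = lam / 2 := by field_simp
    linarith
  obtain ⟨w, hw0, hw1, hw2⟩ := Finset.mem_convexHull'.1 hmem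
  have hwle : ∀ x ∈ F, w x ≤ 1 := fun x hx => by
    rw [← hw1]; exact Finset.single_le_sum hw0 hx
  rw [← hsum w] at hw1
  rw [← hsum (fun y => w y • y)] at hw2
  have hβ1 : ∑ ν, (ε + a' * w (r ν)) = a := by
    rw [Finset.sum_add_distrib, ← Finset.mul_sum, hw1]
    simp [hεN]
    linarith
  have hβ2 : ∑ ν, (ε + a' * w (r ν)) • r ν = b := by
    simp_rw [add_smul, mul_smul]
    rw [Finset.sum_add_distrib, ← Finset.smul_sum, ← Finset.smul_sum, hw2,
      smul_inv_smul₀ ha'0.ne', hb']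
    abel
  refine ⟨fun ν => ε + a' * w (r ν), ?_, ?_⟩
  · intro ν
    have h1 := hw0 (r ν) (F.equivFin.symm ν).2
    have h2 := hwle (r ν) (F.equivFin.symm ν).2
    constructor
    · nlinarith
    · nlinarith
  · simp_rw [← hV2]
    generalize hβdef : (fun ν => ε + a' * w (r ν)) = β at *
    have hβ' : ∀ ν, ε + a' * w (r ν) = β ν := fun ν => congrFun hβdef ν
    simp_rw [hβ'] at hβ1 hβ2 ⊢
    have hβ2' : ∀ i, b i = ∑ ν, β ν * r ν i := by
      intro i; rw [← hβ2]; simp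
    rw [hAeq]
    ext i j
    rw [Matrix.sum_apply]
    fin_cases i <;> fin_cases j <;>
      simp [bloch, hβ2', ← hβ1, mul_add, mul_sub, Finset.sum_add_distrib,
        Finset.sum_sub_distrib, Finset.sum_mul, mul_assoc]
end
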